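/- Let S = ⊕_{n≥0} S_n be a d-dimensional standard graded Noetherian algebra with S_0 = k an infinite field, put 𝔫 = S_+ and R = S_𝔫. Let r > 0 be an integer, let J be an ideal of S generated by homogeneous elements of degree r, and put I = JR. Suppose ℓ(I) = d and J satisfies G_d. Then for general homogeneous elements f_1, …, f_{d−1} ∈ J of degree r, j(I) = r · e(S/((f_1, …, f_{d−1}) :_S J)), where e(−) denotes the Hilbert–Samuel multiplicity with respect to 𝔫. -/

import Mathlib

open Filter

noncomputable section

/-- The length of a module, as the height of `⊤` in the submodule lattice. -/
def mLength (R M : Type*) [CommRing R] [AddCommGroup M] [Module R M] : ℕ∞ :=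
  Order.height (⊤ : Submodule R M)

/-- The Krull dimension of a module, via the annihilator. -/
def mDim (R M : Type*) [CommRing R] [AddCommGroup M] [Module R M] : WithBot ℕ∞ :=
  ringKrullDim (R ⧸ Module.annihilator R M)

/-- `H⁰_I(N)`: elements killed by a power of `I` (0-th local cohomology). -/
def H0 {R : Type*} [CommRing R] (I : Ideal R) (N : Type*) [AddCommGroup N] [Module R N] :
    Submodule R N :=
  ⨆ n : ℕ, Submodule.torsionBySet R N ((I ^ n : Ideal R) : Set R)

/-- `IⁿM/I^{n+1}M`, as a submodule of `M/I^{n+1}M`. -/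
def gradedPiece {R : Type*} [CommRing R] (I : Ideal R) {M : Type*} [AddCommGroup M]
    [Module R M] (n : ℕ) : Submodule R (M ⧸ (I ^ (n + 1) • ⊤ : Submodule R M)) :=
  Submodule.map (I ^ (n + 1) • ⊤ : Submodule R M).mkQ (I ^ n • ⊤ : Submodule R M)

/-- The `j`-multiplicity `j_d(I, M)`, defined as
`lim_n (d−1)!/n^(d−1) · length_R (H⁰_𝔪(IⁿM/I^{n+1}M))`. -/
def jMult {R : Type*} [CommRing R] (𝔪 I : Ideal R) (M : Type*) [AddCommGroup M]
    [Module R M] (d : ℕ) : ℝ :=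
  limUnder atTop fun n : ℕ =>
    ((d - 1).factorial : ℝ) / (n : ℝ) ^ (d - 1) *
      ((mLength R (H0 𝔪 (gradedPiece I (M := M) n))).toNat : ℝ)

/-- The Hilbert–Samuel multiplicity `e(I; N)` of a `d`-dimensional module `N`
(equal to `0` if `N = 0`), defined as `lim_n d!/n^d · length_R (N/IⁿN)`. -/
def hsMult {R : Type*} [CommRing R] (I : Ideal R) (N : Type*) [AddCommGroup N]
    [Module R N] (d : ℕ) : ℝ :=
  limUnder atTop fun n : ℕ =>
    (d.factorial : ℝ) / (n : ℝ) ^ d *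
      ((mLength R (N ⧸ (I ^ n • ⊤ : Submodule R N))).toNat : ℝ)

/-- `K :_M I^∞ = ⋃ₙ (K :_M Iⁿ)`. -/
def satur {R : Type*} [CommRing R] (I : Ideal R) {M : Type*} [AddCommGroup M] [Module R M]
    (K : Submodule R M) : Submodule R M :=
  Submodule.comap K.mkQ (H0 I (M ⧸ K))

/-- "For general elements `a₁, …, aᵢ` of `I`", i.e. for all `i`-tuples of elements of `I`
whose coefficient vectors with respect to any finite generating set of `I` avoid the zero
locus of some nonzero polynomial over the residue field `R/𝔪` (equivalently, whose images
lie in a suitable nonempty Zariski-open set of choices modulo `𝔪I`), property `P` holds. -/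
def GeneralElts {R : Type*} [CommRing R] (𝔪 I : Ideal R) (i : ℕ)
    (P : (Fin i → R) → Prop) : Prop :=
  ∀ (m : ℕ) (x : Fin m → R), Ideal.span (Set.range x) = I →
    ∃ F : MvPolynomial (Fin i × Fin m) R,
      MvPolynomial.map (Ideal.Quotient.mk 𝔪) F ≠ 0 ∧
      ∀ c : Fin i × Fin m → R,
        MvPolynomial.eval (fun p => Ideal.Quotient.mk 𝔪 (c p))
          (MvPolynomial.map (Ideal.Quotient.mk 𝔪) F) ≠ 0 →
        P fun j => ∑ l, c (j, l) * x l

/-- The irrelevant ideal `S₊` of a positively graded ring. -/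
def gPlus {k S : Type*} [CommRing k] [CommRing S] [Algebra k S]
    (𝒜 : ℕ → Submodule k S) : Ideal S :=
  Ideal.span {x : S | ∃ n : ℕ, 0 < n ∧ x ∈ 𝒜 n}

/-- The analytic spread `ℓ(I)`: the Krull dimension of the special fiber ring
`R(I)/𝔪R(I)` of the Rees algebra (which equals `dim gr_I(R)/𝔪·gr_I(R)`). -/
def idealSpread {R : Type*} [CommRing R] (𝔪 I : Ideal R) : WithBot ℕ∞ :=
  ringKrullDim (reesAlgebra I ⧸ Ideal.map (algebraMap R (reesAlgebra I)) 𝔪)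

/-- The minimal number of generators of an ideal. -/
def mu {A : Type*} [CommRing A] (J : Ideal A) : ℕ∞ :=
  sInf ((fun s : Finset A => (s.card : ℕ∞)) '' {s | Ideal.span (s : Set A) = J})

/-- The condition `G_s`: `μ(J_P) ≤ ht P` for every prime `P ⊇ J` with `ht P < s`. -/
def SatisfiesG {S : Type*} [CommRing S] (J : Ideal S) (s : ℕ) : Prop :=
  ∀ p : PrimeSpectrum S, J ≤ p.asIdeal → Order.height p < (s : ℕ∞) →
    mu (Ideal.map (algebraMap S (Localization.AtPrime p.asIdeal)) J) ≤ Order.height p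

/-- "For general homogeneous elements `f₁, …, fᵢ ∈ J` of degree `r`": for every finite
family of degree-`r` homogeneous generators of `J` there is a nonzero polynomial over the
field `k` such that `P` holds for all coefficient combinations avoiding its zero locus
(i.e. for all tuples in a suitable nonempty Zariski-open set of choices). -/
def GeneralHomog {k S : Type*} [Field k] [CommRing S] [Algebra k S]
    (𝒜 : ℕ → Submodule k S) (r : ℕ) (J : Ideal S) (i : ℕ)
    (P : (Fin i → S) → Prop) : Prop :=
  ∀ (m : ℕ) (x : Fin m → S), (∀ l, x l ∈ 𝒜 r) → Ideal.span (Set.range x) = J →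
    ∃ F : MvPolynomial (Fin i × Fin m) k, F ≠ 0 ∧
      ∀ c : Fin i × Fin m → k, MvPolynomial.eval c F ≠ 0 →
        P fun j => ∑ l, c (j, l) • x l

open Asymptotics in
/-- `w n ≤ δ * (n choose j) + o(n ^ j)`. -/
def GrowthLE (w : ℕ → ℝ) (j : ℕ) (δ : ℝ) : Prop :=
  ∃ e : ℕ → ℝ, e =o[atTop] (fun n : ℕ => (n : ℝ) ^ j) ∧
    ∀ᶠ n in atTop, w n ≤ δ * (n.choose j : ℝ) + e n

lemma isLittleO_pow_succ (j : ℕ) :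
    (fun n : ℕ => (n : ℝ) ^ j) =o[atTop] (fun n : ℕ => (n : ℝ) ^ (j + 1)) := by
  have := (Asymptotics.isLittleO_pow_pow_atTop_of_lt (𝕜 := ℝ) (Nat.lt_succ_self j))
  exact this.comp_tendsto tendsto_natCast_atTop_atTop

lemma isBigO_choose (j : ℕ) :
    (fun n : ℕ => (n.choose j : ℝ)) =O[atTop] (fun n : ℕ => (n : ℝ) ^ j) := by
  refine Asymptotics.IsBigO.of_bound 1 (Eventually.of_forall fun n => ?_)
  rw [one_mul, Real.norm_of_nonneg (by positivity), Real.norm_of_nonneg (by positivity)]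
  exact_mod_cast Nat.choose_le_pow n j

lemma isLittleO_sum_range_pow {e : ℕ → ℝ} {j : ℕ}
    (he : e =o[atTop] (fun n : ℕ => (n : ℝ) ^ j)) :
    (fun n => ∑ l ∈ Finset.range n, e l) =o[atTop] (fun n : ℕ => (n : ℝ) ^ (j + 1)) := by
  have h1 : e =o[atTop] (fun n : ℕ => ((n : ℝ) + 1) ^ j) := by
    refine he.trans_le fun n => ?_
    rw [Real.norm_of_nonneg (by positivity), Real.norm_of_nonneg (by positivity)]
    gcongr
    linarith
  have h2 := h1.sum_range (fun n => by positivity) (by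
    refine tendsto_atTop_mono (f := fun n : ℕ => (n : ℝ)) (fun n => ?_)
      tendsto_natCast_atTop_atTop
    calc (n : ℝ) = ∑ _l ∈ Finset.range n, (1 : ℝ) := by simp
      _ ≤ _ := Finset.sum_le_sum fun l _ => one_le_pow₀ (by linarith [Nat.cast_nonneg (α := ℝ) l]))
  refine h2.trans_le fun n => ?_
  rw [Real.norm_of_nonneg (by positivity), Real.norm_of_nonneg (by positivity)]
  calc ∑ l ∈ Finset.range n, ((l : ℝ) + 1) ^ j ≤ ∑ _l ∈ Finset.range n, (n : ℝ) ^ j := by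
        refine Finset.sum_le_sum fun l hl => ?_
        gcongr
        exact_mod_cast Finset.mem_range.1 hl
    _ = (n : ℝ) ^ (j + 1) := by simp [pow_succ']

lemma GrowthLE.mono {w v : ℕ → ℝ} {j : ℕ} {δ : ℝ} (h : GrowthLE v j δ)
    (hwv : ∀ᶠ n in atTop, w n ≤ v n) : GrowthLE w j δ := by
  obtain ⟨e, he, hv⟩ := h
  exact ⟨e, he, by filter_upwards [hv, hwv] with n h1 h2 using h2.trans h1⟩

lemma GrowthLE.const {w : ℕ → ℝ} {δ : ℝ} (h : ∀ᶠ n in atTop, w n ≤ δ) : GrowthLE w 0 δ :=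
  ⟨0, Asymptotics.isLittleO_zero _ _, by filter_upwards [h] with n hn; simpa using hn⟩

lemma GrowthLE.step {w v : ℕ → ℝ} {j : ℕ} {δ : ℝ} (h : GrowthLE v j δ)
    (hwv : ∀ᶠ n in atTop, w (n + 1) ≤ w n + v (n + 1)) : GrowthLE w (j + 1) δ := by
  obtain ⟨e, he, hv⟩ := h
  obtain ⟨n₀, hn₀⟩ := eventually_atTop.1 (hwv.and ((tendsto_add_atTop_nat 1).eventually hv))
  set C : ℝ := w n₀ - δ * (n₀ + 1 : ℕ).choose (j + 1) - ∑ l ∈ Finset.range (n₀ + 1), e l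
  refine ⟨fun n => C + δ * n.choose j + (∑ l ∈ Finset.range n, e l) + e n, ?_, ?_⟩
  · have hC : (fun _ : ℕ => C) =o[atTop] (fun n : ℕ => (n : ℝ) ^ (j + 1)) :=
      Asymptotics.isLittleO_const_left.2 (Or.inr (tendsto_norm_atTop_atTop.comp
        ((tendsto_pow_atTop (Nat.succ_ne_zero j)).comp tendsto_natCast_atTop_atTop)))
    refine ((hC.add ?_).add (isLittleO_sum_range_pow he)).add (he.trans (isLittleO_pow_succ j))
    exact ((isBigO_choose j).trans_isLittleO (isLittleO_pow_succ j)).const_mul_left δ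
  · refine eventually_atTop.2 ⟨n₀, fun n hn => ?_⟩
    induction n, hn using Nat.le_induction with
    | base =>
      simp only [C, Finset.sum_range_succ, Nat.choose_succ_succ n₀ j, Nat.succ_eq_add_one]
      push_cast
      linarith
    | succ n hn ih =>
      obtain ⟨h1, h2⟩ := hn₀ n hn
      simp only [Finset.sum_range_succ, Nat.choose_succ_succ n j, Nat.succ_eq_add_one] at ih ⊢
      push_cast at ih ⊢
      linarith

lemma tendsto_choose_normalized (j : ℕ) :
    Tendsto (fun n : ℕ => (j.factorial : ℝ) / (n : ℝ) ^ j * (n.choose j : ℝ)) atTop (nhds 1) := by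
  have h := (isEquivalent_choose j)
  have h2 := (Asymptotics.isEquivalent_iff_tendsto_one ?_).1 h
  · refine h2.congr fun n => ?_
    simp only [Pi.div_apply]
    rw [div_div_eq_mul_div]; ring
  · filter_upwards [eventually_gt_atTop 0] with n hn
    positivity

lemma tendsto_normalized_of_isLittleO {e : ℕ → ℝ} {j : ℕ} (c : ℝ)
    (he : e =o[atTop] (fun n : ℕ => (n : ℝ) ^ j)) :
    Tendsto (fun n : ℕ => c / (n : ℝ) ^ j * e n) atTop (nhds 0) := by
  have := he.tendsto_div_nhds_zero.const_mul c
  rw [mul_zero] at this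
  exact this.congr fun n => by ring

lemma GrowthLE.exists_bound {w : ℕ → ℝ} {j : ℕ} {δ : ℝ} (h : GrowthLE w j δ) :
    ∃ g : ℕ → ℝ, Tendsto g atTop (nhds δ) ∧
      ∀ᶠ n : ℕ in atTop, (j.factorial : ℝ) / (n : ℝ) ^ j * w n ≤ g n := by
  obtain ⟨e, he, hw⟩ := h
  refine ⟨fun n => δ * ((j.factorial : ℝ) / (n : ℝ) ^ j * (n.choose j : ℝ)) +
    (j.factorial : ℝ) / (n : ℝ) ^ j * e n, ?_, ?_⟩
  · simpa using ((tendsto_choose_normalized j).const_mul δ).add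
      (tendsto_normalized_of_isLittleO _ he)
  · filter_upwards [hw] with n hn
    calc _ ≤ (j.factorial : ℝ) / (n : ℝ) ^ j * (δ * n.choose j + e n) := by gcongr
      _ = _ := by ring

lemma GrowthLE.tendsto {w : ℕ → ℝ} {j : ℕ} {δ : ℝ} (h : GrowthLE w j δ)
    (h' : GrowthLE (fun n => -w n) j (-δ)) :
    Tendsto (fun n : ℕ => (j.factorial : ℝ) / (n : ℝ) ^ j * w n) atTop (nhds δ) := by
  obtain ⟨g, hg, hw⟩ := h.exists_bound
  obtain ⟨g', hg', hw'⟩ := h'.exists_bound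
  refine tendsto_of_tendsto_of_tendsto_of_le_of_le' (by simpa using hg'.neg) hg ?_ hw
  filter_upwards [hw'] with n hn
  linarith

lemma GrowthLE.le_of_tendsto {w : ℕ → ℝ} {j : ℕ} {δ m : ℝ} (h : GrowthLE w j δ)
    (h' : Tendsto (fun n : ℕ => (j.factorial : ℝ) / (n : ℝ) ^ j * w n) atTop (nhds m)) :
    m ≤ δ := by
  obtain ⟨g, hg, hw⟩ := h.exists_bound
  exact le_of_tendsto_of_tendsto h' hg hw
lemma sum_window_succ {M : Type*} [AddCommMonoid M] (q : ℕ → M) (r b : ℕ) :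
    ∑ i ∈ Finset.range r, q (b + 1 + i) + q b = ∑ i ∈ Finset.range r, q (b + i) + q (b + r) := by
  rw [← Finset.sum_range_succ, Finset.sum_range_succ', add_zero]
  simp only [add_assoc, add_comm 1]

lemma sum_window_eq {q : ℕ → ℝ} {r b₀ : ℕ} (hq : ∀ b, b₀ ≤ b → q (b + r) = q b) {b : ℕ}
    (hb : b₀ ≤ b) : ∑ i ∈ Finset.range r, q (b + i) = ∑ i ∈ Finset.range r, q (b₀ + i) := by
  induction b, hb using Nat.le_induction with
  | base => rfl
  | succ n hn ih =>
    have := sum_window_succ q r n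
    rw [hq n hn, ih] at this
    exact add_right_cancel this

lemma exists_periodic_of_le {g : ℕ → ℕ} {r a : ℕ} (h : ∀ b, a ≤ b → g (b + r) ≤ g b) :
    ∃ b₀, a ≤ b₀ ∧ ∀ b, b₀ ≤ b → g (b + r) = g b := by
  set G : ℕ → ℕ := fun b => ∑ i ∈ Finset.range r, g (a + b + i) with hG
  have key : ∀ b, G (b + 1) + g (a + b) = G b + g (a + b + r) := fun b =>
    sum_window_succ g r (a + b)
  have hanti : Antitone G := antitone_nat_of_succ_le fun b => by
    have h1 := key b
    have h2 := h (a + b) (by omega)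
    omega
  obtain ⟨n, hn⟩ : ∃ n, ∀ m, n ≤ m → G n = G m := by
    refine ⟨Function.argmin G, fun m hm => le_antisymm (Function.argmin_le G m) (hanti hm)⟩
  refine ⟨a + n, by omega, fun b hb => ?_⟩
  obtain ⟨c, rfl⟩ := Nat.exists_eq_add_of_le hb
  have h1 := key (n + c)
  have h2 : G n = G (n + c) := hn _ (by omega)
  have h3 : G n = G (n + c + 1) := hn _ (by omega)
  rw [← add_assoc] at h1
  omega

lemma exists_bound_of_periodic {E : ℕ → ℝ} {r b₀ : ℕ} (hr : 0 < r)
    (h : ∀ n, b₀ ≤ n → E (n + r) = E n) : ∃ C, ∀ n, |E n| ≤ C := by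
  refine ⟨∑ i ∈ Finset.range (b₀ + r), |E i|, fun n => ?_⟩
  induction n using Nat.strong_induction_on with
  | _ n ih =>
    by_cases hn : n < b₀ + r
    · exact Finset.single_le_sum (f := fun i => |E i|) (fun i _ => abs_nonneg _)
        (Finset.mem_range.2 hn)
    · obtain ⟨c, rfl⟩ := Nat.exists_eq_add_of_le (not_lt.1 hn)
      have := h (b₀ + c) (by omega)
      rw [show b₀ + r + c = b₀ + c + r by ring, this]
      exact ih _ (by omega)

lemma tendsto_average_of_periodic {q : ℕ → ℝ} {r b₀ : ℕ} (hr : 0 < r)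
    (hq : ∀ b, b₀ ≤ b → q (b + r) = q b) :
    Tendsto (fun n : ℕ => (1 / (n : ℝ)) * ∑ c ∈ Finset.range n, q c) atTop
      (nhds ((∑ i ∈ Finset.range r, q (b₀ + i)) / r)) := by
  set T := ∑ i ∈ Finset.range r, q (b₀ + i) with hT
  have hr' : (r : ℝ) ≠ 0 := by positivity
  obtain ⟨C, hC⟩ := exists_bound_of_periodic (b₀ := b₀)
    (E := fun n => ∑ c ∈ Finset.range n, q c - n * (T / r)) hr (fun n hn => by
      rw [Finset.sum_range_add, sum_window_eq hq hn, ← hT]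
      push_cast
      field_simp
      ring)
  have h0 : Tendsto (fun n : ℕ => (1 / (n : ℝ)) *
      (∑ c ∈ Finset.range n, q c - n * (T / r))) atTop (nhds 0) := by
    refine squeeze_zero_norm (a := fun n : ℕ => (1 / (n : ℝ)) * C) (fun n => ?_) ?_
    · rw [norm_mul, Real.norm_of_nonneg (by positivity : (0 : ℝ) ≤ 1 / (n : ℝ))]
      gcongr
      exact hC n
    · simpa using (tendsto_one_div_atTop_nhds_zero_nat (𝕜 := ℝ)).mul_const C
  have h1 := h0.add_const (T / r)
  rw [zero_add] at h1
  refine h1.congr' ?_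
  filter_upwards [eventually_gt_atTop 0] with n hn
  have : (n : ℝ) ≠ 0 := by positivity
  field_simp
  ring

lemma tendsto_diff_of_convex {u : ℕ → ℝ} {j : ℕ} (c : ℝ) (h0 : ∀ n, 0 ≤ u n)
    (hmono : ∀ᶠ n in atTop, u n ≤ u (n + 1))
    (hconv : ∀ᶠ n in atTop, u (n + 1) - u n ≤ u (n + 2) - u (n + 1))
    (hO : u =O[atTop] (fun n : ℕ => (n : ℝ) ^ j)) :
    Tendsto (fun n : ℕ => c / (n : ℝ) ^ j * (u (n + 1) - u n)) atTop (nhds 0) := by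
  obtain ⟨C, hC⟩ := hO.bound
  obtain ⟨n₀, hn₀⟩ := eventually_atTop.1 (hmono.and (hconv.and hC))
  have hd : ∀ n, n₀ ≤ n → ∀ i, u (n + 1) - u n ≤ u (n + i + 1) - u (n + i) := by
    intro n hn i
    induction i with
    | zero => rfl
    | succ i ih => exact ih.trans (hn₀ (n + i) (by omega)).2.1
  have hs : ∀ n, n₀ ≤ n → ∀ i : ℕ, i * (u (n + 1) - u n) ≤ u (n + i) - u n := by
    intro n hn i
    induction i with
    | zero => simp
    | succ i ih =>
      have := hd n hn i
      push_cast
      rw [← add_assoc]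
      linarith
  have hb : (fun n => u (n + 1) - u n) =o[atTop] (fun n : ℕ => (n : ℝ) ^ j) := by
    have h1 : (fun n => u (n + 1) - u n) =O[atTop]
        (fun n : ℕ => (1 / (n : ℝ)) * (n : ℝ) ^ j) := by
      refine Asymptotics.IsBigO.of_bound (C * 2 ^ j) ?_
      filter_upwards [eventually_ge_atTop n₀, eventually_gt_atTop 0] with n hn hn'
      have h2 := hs n hn n
      have h3 := (hn₀ (n + n) (by omega)).2.2
      have h4 := (hn₀ n hn).1
      rw [Real.norm_of_nonneg (h0 _), Real.norm_of_nonneg (by positivity)] at h3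
      rw [Real.norm_of_nonneg (by linarith), Real.norm_of_nonneg (by positivity)]
      have h5 : (n : ℝ) * (u (n + 1) - u n) ≤ C * 2 ^ j * (n : ℝ) ^ j := by
        have : C * ((n + n : ℕ) : ℝ) ^ j = C * 2 ^ j * (n : ℝ) ^ j := by
          push_cast; rw [← two_mul, mul_pow]; ring
        linarith [h0 n]
      have hn0 : (0 : ℝ) < n := by positivity
      calc u (n + 1) - u n = (1 / (n : ℝ)) * (n * (u (n + 1) - u n)) := by field_simp
        _ ≤ (1 / (n : ℝ)) * (C * 2 ^ j * (n : ℝ) ^ j) := by gcongr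
        _ = _ := by ring
    refine h1.trans_isLittleO ?_
    have h2 : (fun n : ℕ => 1 / (n : ℝ)) =o[atTop] (fun _ : ℕ => (1 : ℝ)) :=
      (Asymptotics.isLittleO_one_iff ℝ).2 tendsto_one_div_atTop_nhds_zero_nat
    simpa using h2.mul_isBigO (Asymptotics.isBigO_refl (fun n : ℕ => (n : ℝ) ^ j) atTop)
  have := hb.tendsto_div_nhds_zero.const_mul c
  rw [mul_zero] at this
  exact this.congr fun n => by ring
section GradedBasics

variable {k S : Type*} [Field k] [CommRing S] [Algebra k S]

lemma mem_ideal_span_of_mem_mul {X Y : Submodule k S} {y : S} (hy : y ∈ X * Y) :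
    y ∈ Ideal.span (X : Set S) := by
  induction hy using Submodule.mul_induction_on' with
  | mem_mul_mem m hm n _ => exact Ideal.mul_mem_right _ _ (Ideal.subset_span hm)
  | add x _ y _ hx hy => exact add_mem hx hy

lemma ideal_span_mul (X Y : Submodule k S) :
    Ideal.span ((X * Y : Submodule k S) : Set S) =
      Ideal.span (X : Set S) * Ideal.span (Y : Set S) := by
  apply le_antisymm
  · rw [Ideal.span_le]
    intro y hy
    induction hy using Submodule.mul_induction_on' with
    | mem_mul_mem m hm n hn =>
      exact Ideal.mul_mem_mul (Ideal.subset_span hm) (Ideal.subset_span hn)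
    | add x _ y _ hx hy => exact add_mem hx hy
  · rw [Ideal.span_mul_span', Ideal.span_le]
    rintro _ ⟨x, hx, y, hy, rfl⟩
    exact Ideal.subset_span (Submodule.mul_mem_mul hx hy)

lemma ideal_span_pow (X : Submodule k S) (n : ℕ) :
    Ideal.span ((X ^ n : Submodule k S) : Set S) = Ideal.span (X : Set S) ^ n := by
  induction n with
  | zero =>
    rw [pow_zero, pow_zero, Ideal.one_eq_top, Ideal.eq_top_iff_one]
    exact Ideal.subset_span (Submodule.mem_one.2 ⟨1, map_one _⟩)
  | succ n ih => rw [pow_succ, pow_succ, ideal_span_mul, ih]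

lemma ideal_span_submodule_span (X : Set S) :
    Ideal.span ((Submodule.span k X : Submodule k S) : Set S) = Ideal.span X :=
  Submodule.span_span_of_tower k S X

variable (𝒜 : ℕ → Submodule k S) [GradedAlgebra 𝒜]

lemma proj_mem (c : ℕ) (y : S) : GradedAlgebra.proj 𝒜 c y ∈ 𝒜 c := by
  rw [GradedAlgebra.proj_apply]; exact SetLike.coe_mem _

variable {𝒜}

lemma proj_eq_self {c : ℕ} {y : S} (hy : y ∈ 𝒜 c) : GradedAlgebra.proj 𝒜 c y = y := by
  rw [GradedAlgebra.proj_apply, DirectSum.decompose_of_mem_same 𝒜 hy]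

lemma proj_eq_zero {c e : ℕ} {y : S} (hy : y ∈ 𝒜 c) (h : c ≠ e) :
    GradedAlgebra.proj 𝒜 e y = 0 := by
  rw [GradedAlgebra.proj_apply, DirectSum.decompose_of_mem_ne 𝒜 hy h]

lemma proj_mul {c b : ℕ} {x : S} (hx : x ∈ 𝒜 c) (y : S) :
    GradedAlgebra.proj 𝒜 (c + b) (x * y) = x * GradedAlgebra.proj 𝒜 b y := by
  rw [GradedAlgebra.proj_apply, GradedAlgebra.proj_apply,
    DirectSum.coe_decompose_mul_add_of_left_mem 𝒜 hx]

lemma proj_mul_of_lt {c b : ℕ} {x : S} (hx : x ∈ 𝒜 c) (hb : b < c) (y : S) :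
    GradedAlgebra.proj 𝒜 b (x * y) = 0 := by
  rw [GradedAlgebra.proj_apply, DirectSum.coe_decompose_mul_of_left_mem_of_not_le 𝒜 hx hb.not_ge]

variable (𝒜) in
lemma exists_eq_sum_proj (y : S) :
    ∃ T : Finset ℕ, y = ∑ c ∈ T, GradedAlgebra.proj 𝒜 c y := by
  classical
  exact ⟨_, (DirectSum.sum_support_decompose 𝒜 y).symm⟩

lemma mem_ideal_of_proj_mem {I : Ideal S} {y : S}
    (h : ∀ c, GradedAlgebra.proj 𝒜 c y ∈ I) : y ∈ I := by
  obtain ⟨T, hT⟩ := exists_eq_sum_proj 𝒜 y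
  rw [hT]
  exact sum_mem fun c _ => h c

lemma proj_mem_mul_of_mem_span {X : Submodule k S} {s : ℕ} (hX : X ≤ 𝒜 s) {y : S}
    (hy : y ∈ Ideal.span (X : Set S)) (b : ℕ) : GradedAlgebra.proj 𝒜 (s + b) y ∈ X * 𝒜 b := by
  suffices ∀ a, GradedAlgebra.proj 𝒜 (s + b) (y * a) ∈ X * 𝒜 b by simpa using this 1
  induction hy using Submodule.span_induction with
  | mem x hx =>
    intro a
    rw [proj_mul (hX hx)]
    exact Submodule.mul_mem_mul hx (proj_mem 𝒜 _ _)
  | zero => simp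
  | add x y _ _ hx hy => intro a; rw [add_mul, map_add]; exact add_mem (hx a) (hy a)
  | smul t y _ hy => intro a; rw [smul_eq_mul, mul_comm t, mul_assoc]; exact hy _

lemma proj_eq_zero_of_mem_span {X : Submodule k S} {s : ℕ} (hX : X ≤ 𝒜 s) {y : S}
    (hy : y ∈ Ideal.span (X : Set S)) {c : ℕ} (hc : c < s) : GradedAlgebra.proj 𝒜 c y = 0 := by
  suffices ∀ a, GradedAlgebra.proj 𝒜 c (y * a) = 0 by simpa using this 1
  induction hy using Submodule.span_induction with
  | mem x hx => exact fun a => proj_mul_of_lt (hX hx) hc a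
  | zero => simp
  | add x y _ _ hx hy => intro a; rw [add_mul, map_add, hx, hy, add_zero]
  | smul t y _ hy => intro a; rw [smul_eq_mul, mul_comm t, mul_assoc]; exact hy _

lemma mem_mul_of_mem_span {X : Submodule k S} {s b : ℕ} (hX : X ≤ 𝒜 s) {y : S}
    (hy : y ∈ Ideal.span (X : Set S)) (hy' : y ∈ 𝒜 (s + b)) : y ∈ X * 𝒜 b := by
  rw [← proj_eq_self hy']; exact proj_mem_mul_of_mem_span hX hy b

variable (hstd : ∀ n : ℕ, 𝒜 n = 𝒜 1 ^ n)

include hstd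
omit [GradedAlgebra 𝒜] in
lemma grade_mul (b c : ℕ) : 𝒜 b * 𝒜 c = 𝒜 (b + c) := by
  rw [hstd b, hstd c, hstd (b + c), pow_add]

omit [GradedAlgebra 𝒜] in
lemma grade_pow (b n : ℕ) : 𝒜 b ^ n = 𝒜 (b * n) := by
  rw [hstd b, hstd (b * n), pow_mul]

omit [GradedAlgebra 𝒜] in
lemma grade_zero : 𝒜 0 = 1 := by rw [hstd 0, pow_zero]

omit [GradedAlgebra 𝒜] in
lemma pow_le_grade {V : Submodule k S} {r : ℕ} (hV : V ≤ 𝒜 r) (n : ℕ) :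
    V ^ n ≤ 𝒜 (r * n) := by
  rw [← grade_pow hstd]; exact pow_le_pow_left' hV n

omit [GradedAlgebra 𝒜] in
lemma pow_mul_le_grade {V : Submodule k S} {r : ℕ} (hV : V ≤ 𝒜 r) (n b : ℕ) :
    V ^ n * 𝒜 b ≤ 𝒜 (r * n + b) := by
  rw [← grade_mul hstd]; exact mul_le_mul' (pow_le_grade hstd hV n) le_rfl

omit [GradedAlgebra 𝒜] in
lemma gPlus_eq : gPlus 𝒜 = Ideal.span (𝒜 1 : Set S) := by
  apply le_antisymm
  · rw [gPlus, Ideal.span_le]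
    rintro x ⟨n, hn, hx⟩
    obtain ⟨n, rfl⟩ := Nat.exists_eq_succ_of_ne_zero hn.ne'
    rw [Nat.succ_eq_add_one, add_comm, ← grade_mul hstd] at hx
    exact mem_ideal_span_of_mem_mul hx
  · exact Ideal.span_mono fun x hx => ⟨1, one_pos, hx⟩

lemma gPlus_pow (n : ℕ) : gPlus 𝒜 ^ n = Ideal.span (𝒜 n : Set S) := by
  rw [gPlus_eq hstd, ← ideal_span_pow, ← hstd]

lemma grade_le_gPlus_pow {n c : ℕ} (h : n ≤ c) {y : S} (hy : y ∈ 𝒜 c) : y ∈ gPlus 𝒜 ^ n := by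
  rw [gPlus_pow hstd]
  obtain ⟨b, rfl⟩ := Nat.exists_eq_add_of_le h
  rw [← grade_mul hstd] at hy
  exact mem_ideal_span_of_mem_mul hy

lemma mem_gPlus_pow_iff {n : ℕ} {y : S} :
    y ∈ gPlus 𝒜 ^ n ↔ ∀ c < n, GradedAlgebra.proj 𝒜 c y = 0 := by
  refine ⟨fun h c hc => ?_, fun h => mem_ideal_of_proj_mem (𝒜 := 𝒜) fun c => ?_⟩
  · rw [gPlus_pow hstd] at h
    exact proj_eq_zero_of_mem_span le_rfl h hc
  · by_cases hc : c < n
    · rw [h c hc]; exact zero_mem _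
    · exact grade_le_gPlus_pow hstd (not_lt.1 hc) (proj_mem 𝒜 _ _)

lemma grade_fg [IsNoetherianRing S] (n : ℕ) : (𝒜 n).FG := by
  rw [hstd n]
  refine Submodule.FG.pow ?_ n
  obtain ⟨T, hT, hspan⟩ := (Submodule.fg_span_iff_fg_span_finset_subset (𝒜 1 : Set S)).1
    (IsNoetherian.noetherian (Ideal.span (𝒜 1 : Set S)))
  have hTle : Submodule.span k (T : Set S) ≤ 𝒜 1 := Submodule.span_le.2 hT
  refine ⟨T, le_antisymm hTle fun y hy => ?_⟩
  have h1 : y ∈ Ideal.span ((Submodule.span k (T : Set S) : Submodule k S) : Set S) := by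
    rw [ideal_span_submodule_span]
    have := Ideal.subset_span (α := S) hy
    rwa [Ideal.span, hspan] at this
  have := mem_mul_of_mem_span (b := 0) hTle h1 hy
  rwa [grade_zero hstd, mul_one] at this

end GradedBasics

section Rank

variable {k S M N : Type*} [Field k] [CommRing S] [Algebra k S] [AddCommGroup M] [Module k M]
  [AddCommGroup N] [Module k N]

/-- The dimension of a `k`-subspace, as a real number. -/
def rk (X : Submodule k M) : ℝ := (Module.finrank k X : ℝ)

lemma rk_nonneg (X : Submodule k M) : 0 ≤ rk X := Nat.cast_nonneg _

lemma rk_bot : rk (⊥ : Submodule k M) = 0 := by simp [rk]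

lemma rk_mono {X Y : Submodule k M} (hY : Y.FG) (h : X ≤ Y) : rk X ≤ rk Y := by
  have := Module.Finite.iff_fg.2 hY
  exact Nat.cast_le.2 (Submodule.finrank_mono h)

lemma eq_of_le_of_rk_le {X Y : Submodule k M} (hY : Y.FG) (h : X ≤ Y) (h' : rk Y ≤ rk X) :
    X = Y := by
  have := Module.Finite.iff_fg.2 hY
  exact Submodule.eq_of_le_of_finrank_le h (Nat.cast_le.1 h')

lemma fg_of_le {X Y : Submodule k M} (hY : Y.FG) (h : X ≤ Y) : X.FG :=
  have := Module.Finite.iff_fg.2 hY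
  Module.Finite.iff_fg.1 (Submodule.finiteDimensional_of_le h)

lemma rk_map_add_rk_inf_ker {X : Submodule k M} (hX : X.FG) (φ : M →ₗ[k] N) :
    rk (X.map φ) + rk (X ⊓ LinearMap.ker φ) = rk X := by
  have := Module.Finite.iff_fg.2 hX
  have := LinearMap.finrank_range_add_finrank_ker (φ.domRestrict X)
  rw [LinearMap.range_domRestrict, LinearMap.ker_domRestrict,
    ← Submodule.finrank_map_subtype_eq, Submodule.map_comap_subtype] at this
  simp only [rk]
  exact_mod_cast this

lemma rk_sup_map_add {X : Submodule k M} {Y : Submodule k N} (hX : X.FG) (hY : Y.FG)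
    (φ : M →ₗ[k] N) :
    rk (Y ⊔ X.map φ) + rk (X ⊓ Y.comap φ) = rk X + rk Y := by
  have := Module.Finite.iff_fg.2 hX
  have := Module.Finite.iff_fg.2 hY
  have := Module.Finite.iff_fg.2 (hX.map φ)
  have h1 := rk_map_add_rk_inf_ker hX φ
  have h2 := rk_map_add_rk_inf_ker (X := X ⊓ Y.comap φ)
    (fg_of_le hX inf_le_left) φ
  have h3 : rk (Y ⊔ X.map φ) + rk (Y ⊓ X.map φ) = rk Y + rk (X.map φ) := by
    simp only [rk]
    exact_mod_cast Submodule.finrank_sup_add_finrank_inf_eq Y (X.map φ)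
  have h4 : (X ⊓ Y.comap φ).map φ = Y ⊓ X.map φ := by
    ext y
    simp only [Submodule.mem_map, Submodule.mem_inf, Submodule.mem_comap]
    exact ⟨fun ⟨x, hx, hxy⟩ => hxy ▸ ⟨hx.2, x, hx.1, rfl⟩,
      fun ⟨hy, x, hx, hxy⟩ => ⟨x, ⟨hx, hxy.symm ▸ hy⟩, hxy⟩⟩
  have h5 : X ⊓ Y.comap φ ⊓ LinearMap.ker φ = X ⊓ LinearMap.ker φ := by
    rw [inf_assoc, inf_eq_right.2 (LinearMap.ker_le_comap φ)]
  rw [h4, h5] at h2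
  linarith

lemma span_singleton_mul_eq_map (g : S) (X : Submodule k S) :
    Submodule.span k {g} * X = X.map (LinearMap.mulLeft k g) := by
  apply le_antisymm
  · rw [Submodule.mul_le]
    intro m hm n hn
    obtain ⟨c, rfl⟩ := Submodule.mem_span_singleton.1 hm
    exact ⟨c • n, X.smul_mem c hn, by simp⟩
  · rintro _ ⟨x, hx, rfl⟩
    exact Submodule.mul_mem_mul (Submodule.mem_span_singleton_self g) hx

/-- The codimension of `L Vⁿ⁻¹ X` in `Vⁿ X` (for `L ≤ V` and `0 < n`). -/
def defect (V L X : Submodule k S) (n : ℕ) : ℝ :=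
  rk (V ^ n * X) - rk (L * (V ^ (n - 1) * X))

lemma defect_bot (V X : Submodule k S) (n : ℕ) : defect V ⊥ X n = rk (V ^ n * X) := by
  simp [defect, rk_bot]

variable {V L X : Submodule k S}

lemma rk_sup_span_mul_add (hV : V.FG) (hL : L.FG) (hX : X.FG) (g : S) (n : ℕ) :
    rk ((L ⊔ Submodule.span k {g}) * (V ^ n * X)) +
      rk (V ^ n * X ⊓ (L * (V ^ n * X)).comap (LinearMap.mulLeft k g)) =
      rk (V ^ n * X) + rk (L * (V ^ n * X)) := by
  rw [Submodule.sup_mul, span_singleton_mul_eq_map]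
  exact rk_sup_map_add ((hV.pow n).mul hX) (hL.mul ((hV.pow n).mul hX)) _

lemma mul_le_inf_comap (hLV : L ≤ V) {g : S} (hg : g ∈ V) (n : ℕ) :
    L * (V ^ n * X) ≤
      V ^ (n + 1) * X ⊓ (L * (V ^ (n + 1) * X)).comap (LinearMap.mulLeft k g) := by
  refine le_inf ?_ ?_
  · rw [pow_succ', mul_assoc]
    exact mul_le_mul' hLV le_rfl
  · rw [← Submodule.map_le_iff_le_comap, ← span_singleton_mul_eq_map, mul_left_comm, pow_succ',
      mul_assoc]
    exact mul_le_mul' le_rfl (mul_le_mul' (by simpa using hg) le_rfl)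

lemma defect_succ_le (hV : V.FG) (hLV : L ≤ V) (hL : L.FG) (hX : X.FG) {g : S} (hg : g ∈ V)
    {n : ℕ} (hn : 1 ≤ n) :
    defect V L X (n + 1) ≤ defect V L X n + defect V (L ⊔ Submodule.span k {g}) X (n + 1) := by
  obtain ⟨n, rfl⟩ := Nat.exists_eq_add_of_le' hn
  have h1 := rk_sup_span_mul_add hV hL hX g (n + 1)
  have h2 := mul_le_inf_comap (X := X) hLV hg n
  have h3 := rk_mono (fg_of_le ((hV.pow (n + 1)).mul hX) inf_le_left) h2
  simp only [defect, Nat.add_sub_cancel]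
  linarith

lemma defect_succ_eq (hV : V.FG) (hLV : L ≤ V) (hL : L.FG) (hX : X.FG) {g : S} (hg : g ∈ V)
    {n : ℕ} (hn : 1 ≤ n)
    (hreg : ∀ x ∈ V ^ n * X, g * x ∈ L * (V ^ n * X) → x ∈ L * (V ^ (n - 1) * X)) :
    defect V L X (n + 1) = defect V L X n + defect V (L ⊔ Submodule.span k {g}) X (n + 1) := by
  obtain ⟨n, rfl⟩ := Nat.exists_eq_add_of_le' hn
  have h1 := rk_sup_span_mul_add hV hL hX g (n + 1)
  rw [← (mul_le_inf_comap (X := X) hLV hg n).antisymm fun x hx => hreg x hx.1 hx.2] at h1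
  simp only [defect, Nat.add_sub_cancel]
  linarith

lemma span_range_snoc (k : Type*) {S : Type*} [Field k] [CommRing S] [Algebra k S] {i : ℕ}
    (f : Fin (i + 1) → S) :
    Submodule.span k (Set.range f) =
      Submodule.span k (Set.range (Fin.init f)) ⊔ Submodule.span k {f (Fin.last i)} := by
  rw [← Submodule.span_union]
  congr 1
  ext x
  simp only [Set.mem_range, Set.mem_union, Set.mem_singleton_iff, Fin.exists_iff_castSucc]
  rw [or_comm, eq_comm]
  rfl

lemma span_range_le {i : ℕ} {f : Fin i → S} (hf : ∀ j, f j ∈ V) :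
    Submodule.span k (Set.range f) ≤ V :=
  Submodule.span_le.2 (Set.range_subset_iff.2 hf)

lemma span_range_fg {i : ℕ} (f : Fin i → S) : (Submodule.span k (Set.range f)).FG :=
  Submodule.fg_span (Set.finite_range f)

lemma growthLE_rk_of_defect (hV : V.FG) (hX : X.FG) {i : ℕ} (f : Fin i → S) (hf : ∀ j, f j ∈ V)
    {j : ℕ} {δ : ℝ} (h : GrowthLE (defect V (Submodule.span k (Set.range f)) X) j δ) :
    GrowthLE (fun n => rk (V ^ n * X)) (j + i) δ := by
  induction i generalizing j with
  | zero =>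
    refine h.mono (Eventually.of_forall fun n => ?_)
    simp [Set.range_eq_empty, defect_bot]
  | succ i ih =>
    rw [add_comm i, ← add_assoc]
    refine ih (Fin.init f) (fun j => hf _) (h.step (eventually_atTop.2 ⟨1, fun n hn => ?_⟩))
    rw [span_range_snoc]
    exact defect_succ_le hV (span_range_le fun j => hf _) (span_range_fg _) hX (hf _) hn

end Rank

section Stabilization

variable {k S : Type*} [Field k] [CommRing S] [Algebra k S] {𝒜 : ℕ → Submodule k S}

/-- Modulo `L`, multiplication by `h` maps degree `a + r` of `(V)` onto degree `a + 2 r`. -/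
def SurjAt (𝒜 : ℕ → Submodule k S) (V L : Submodule k S) (h : S) (r a : ℕ) : Prop :=
  V * 𝒜 (a + r) ≤ L * 𝒜 (a + r) ⊔ Submodule.span k {h} * (V * 𝒜 a)

variable (hstd : ∀ n : ℕ, 𝒜 n = 𝒜 1 ^ n) {V L : Submodule k S} {h : S} {r a : ℕ}

include hstd

lemma SurjAt.mono (hC : SurjAt 𝒜 V L h r a) {b : ℕ} (hb : a ≤ b) : SurjAt 𝒜 V L h r b := by
  obtain ⟨c, rfl⟩ := Nat.exists_eq_add_of_le hb
  have := mul_le_mul' hC (le_refl (𝒜 c))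
  simp only [Submodule.sup_mul, mul_assoc, grade_mul hstd] at this
  rwa [add_right_comm] at this

lemma SurjAt.pow_succ_mul_le (hC : SurjAt 𝒜 V L h r a) (hV : V ≤ 𝒜 r) {b n : ℕ}
    (hb : a + r ≤ b) (hn : 1 ≤ n) :
    V ^ (n + 1) * 𝒜 b ≤ L * (V ^ n * 𝒜 b) ⊔ Submodule.span k {h} * (V ^ n * 𝒜 b) := by
  obtain ⟨n, rfl⟩ := Nat.exists_eq_add_of_le' hn
  obtain ⟨c, rfl⟩ := Nat.exists_eq_add_of_le' (le_trans le_add_self hb)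
  have h1 := mul_le_mul' (le_refl (V ^ (n + 1))) (hC.mono hstd (b := c) (by omega))
  rw [← mul_assoc, ← pow_succ, Submodule.mul_sup, mul_left_comm _ L,
    mul_left_comm _ (Submodule.span k {h})] at h1
  refine h1.trans (sup_le_sup le_rfl (mul_le_mul' le_rfl (mul_le_mul' le_rfl ?_)))
  rw [add_comm c, ← grade_mul hstd]
  exact mul_le_mul' hV le_rfl

variable (hfg : ∀ n, (𝒜 n).FG) (hVr : V ≤ 𝒜 r) (hV : V.FG) (hLV : L ≤ V) (hh : h ∈ V)

include hfg hVr hV hLV hh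

omit hfg hV hLV in
lemma span_mul_le (b : ℕ) : Submodule.span k {h} * (V * 𝒜 b) ≤ V * 𝒜 (b + r) := by
  rw [mul_left_comm, add_comm b, ← grade_mul hstd]
  exact mul_le_mul' le_rfl (mul_le_mul' (by simpa using hVr hh) le_rfl)

omit hfg hV hLV in
lemma mul_le_comap (b : ℕ) : L * 𝒜 b ≤ (L * 𝒜 (b + r)).comap (LinearMap.mulLeft k h) := by
  rw [← Submodule.map_le_iff_le_comap, ← span_singleton_mul_eq_map, mul_left_comm, add_comm b,
    ← grade_mul hstd]
  exact mul_le_mul' le_rfl (mul_le_mul' (by simpa using hVr hh) le_rfl)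

lemma SurjAt.rk_add (hC : SurjAt 𝒜 V L h r a) {b : ℕ} (hb : a ≤ b) :
    rk (V * 𝒜 (b + r)) + rk (V * 𝒜 b ⊓ (L * 𝒜 (b + r)).comap (LinearMap.mulLeft k h)) =
      rk (V * 𝒜 b) + rk (L * 𝒜 (b + r)) := by
  rw [← rk_sup_map_add (hV.mul (hfg b)) ((fg_of_le hV hLV).mul (hfg _)),
    ← span_singleton_mul_eq_map,
    ((hC.mono hstd hb).antisymm (sup_le (mul_le_mul' hLV le_rfl) (span_mul_le hstd hVr hh b)))]

lemma SurjAt.defect_add_le (hC : SurjAt 𝒜 V L h r a) {b : ℕ} (hb : a ≤ b) :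
    defect V L (𝒜 (b + r)) 1 ≤ defect V L (𝒜 b) 1 := by
  have h1 := hC.rk_add hstd hfg hVr hV hLV hh hb
  have h2 := rk_mono (fg_of_le (hV.mul (hfg b)) inf_le_left)
    (le_inf (mul_le_mul' hLV le_rfl) (mul_le_comap (L := L) hstd hVr hh b))
  simp only [defect, pow_one, Nat.sub_self, pow_zero, one_mul]
  linarith

lemma SurjAt.mem_of_mul_mem (hC : SurjAt 𝒜 V L h r a) {b : ℕ} (hb : a ≤ b)
    (heq : defect V L (𝒜 (b + r)) 1 = defect V L (𝒜 b) 1) {x : S} (hx : x ∈ V * 𝒜 b)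
    (hhx : h * x ∈ L * 𝒜 (b + r)) : x ∈ L * 𝒜 b := by
  have h1 := hC.rk_add hstd hfg hVr hV hLV hh hb
  simp only [defect, pow_one, Nat.sub_self, pow_zero, one_mul] at heq
  rw [eq_of_le_of_rk_le (fg_of_le (hV.mul (hfg b)) inf_le_left)
    (le_inf (mul_le_mul' hLV le_rfl) (mul_le_comap (L := L) hstd hVr hh b)) (by linarith)]
  exact ⟨hx, hhx⟩

lemma SurjAt.defect_le (hC : SurjAt 𝒜 V L h r a) {b n : ℕ} (hb : a + r ≤ b) (hn : 1 ≤ n) :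
    defect V L (𝒜 b) n ≤ defect V L (𝒜 b) 1 := by
  induction n, hn using Nat.le_induction with
  | base => rfl
  | succ n hn ih =>
    refine le_trans ?_ ih
    have hL := fg_of_le hV hLV
    have h1 := rk_sup_span_mul_add hV hL (hfg b) h n
    obtain ⟨n, rfl⟩ := Nat.exists_eq_add_of_le' hn
    have h2 := rk_mono (fg_of_le ((hV.pow (n + 1)).mul (hfg b)) inf_le_left)
      (mul_le_inf_comap (X := 𝒜 b) hLV hh n)
    have h3 := hC.pow_succ_mul_le hstd hVr hb hn
    rw [← Submodule.sup_mul] at h3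
    have h4 := rk_mono ((hL.sup (Submodule.fg_span_singleton h)).mul
      ((hV.pow (n + 1)).mul (hfg b))) h3
    simp only [defect, Nat.add_sub_cancel]
    linarith

lemma SurjAt.exists_stable (hC : SurjAt 𝒜 V L h r a) :
    ∃ b₀, a + r ≤ b₀ ∧ ∀ b, b₀ ≤ b → defect V L (𝒜 (b + r)) 1 = defect V L (𝒜 b) 1 := by
  have hnat : ∀ b, defect V L (𝒜 b) 1 =
      (Module.finrank k ↥(V * 𝒜 b) - Module.finrank k ↥(L * 𝒜 b) : ℕ) := fun b => by
    have := Module.Finite.iff_fg.2 (hV.mul (hfg b))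
    rw [Nat.cast_sub (Submodule.finrank_mono (mul_le_mul' hLV le_rfl))]
    simp only [defect, pow_one, Nat.sub_self, pow_zero, one_mul]
    rfl
  obtain ⟨b₀, hb₀, hp⟩ := exists_periodic_of_le (r := r) (a := a + r)
    (g := fun b => Module.finrank k ↥(V * 𝒜 b) - Module.finrank k ↥(L * 𝒜 b)) fun b hb => by
      have := hC.defect_add_le hstd hfg hVr hV hLV hh (b := b) (by omega)
      rw [hnat, hnat] at this
      exact_mod_cast this
  exact ⟨b₀, hb₀, fun b hb => by rw [hnat, hnat]; exact_mod_cast hp b hb⟩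

variable {b₀ : ℕ} (hab : a + r ≤ b₀)
  (hst : ∀ b, b₀ ≤ b → defect V L (𝒜 (b + r)) 1 = defect V L (𝒜 b) 1)

include hab hst

lemma SurjAt.le_defect (hC : SurjAt 𝒜 V L h r a) {b n : ℕ} (hb : b₀ ≤ b) (hn : 1 ≤ n) :
    defect V L (𝒜 b) 1 ≤ defect V L (𝒜 b) n := by
  obtain ⟨n, rfl⟩ := Nat.exists_eq_add_of_le' hn
  have hL := fg_of_le hV hLV
  have hinj : ∀ n x, x ∈ V * 𝒜 b → h ^ n * x ∈ L * 𝒜 (b + r * n) → x ∈ L * 𝒜 b := by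
    intro n
    induction n with
    | zero => intro x _ hx; simpa using hx
    | succ n ih =>
      intro x hx hhx
      refine ih x hx (hC.mem_of_mul_mem hstd hfg hVr hV hLV hh (by omega)
        (hst (b + r * n) (by omega)) ?_ ?_)
      · rw [add_comm b, ← grade_mul hstd, mul_left_comm]
        exact Submodule.mul_mem_mul (pow_le_grade hstd hVr n (Submodule.pow_mem_pow V hh n)) hx
      · rw [← mul_assoc, ← pow_succ']
        rwa [mul_add, mul_one, ← add_assoc] at hhx
  have h1 := rk_sup_map_add (hV.mul (hfg b)) (hL.mul ((hV.pow n).mul (hfg b)))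
    (LinearMap.mulLeft k (h ^ n))
  have h2 : L * (V ^ n * 𝒜 b) ⊔ (V * 𝒜 b).map (LinearMap.mulLeft k (h ^ n)) ≤
      V ^ (n + 1) * 𝒜 b := by
    rw [← span_singleton_mul_eq_map]
    refine sup_le ?_ ?_
    · rw [pow_succ', mul_assoc]; exact mul_le_mul' hLV le_rfl
    · rw [pow_succ, mul_assoc]
      exact mul_le_mul' (by simpa using Submodule.pow_mem_pow V hh n) le_rfl
  have h3 : V * 𝒜 b ⊓ (L * (V ^ n * 𝒜 b)).comap (LinearMap.mulLeft k (h ^ n)) ≤ L * 𝒜 b := by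
    rintro x ⟨hx, hhx⟩
    refine hinj n x hx (SetLike.le_def.1 (mul_le_mul' le_rfl ?_) hhx)
    rw [add_comm]
    exact pow_mul_le_grade hstd hVr n b
  have h4 := rk_mono ((hV.pow (n + 1)).mul (hfg b)) h2
  have h5 := rk_mono (hL.mul (hfg b)) h3
  simp only [defect, Nat.add_sub_cancel, pow_one, Nat.sub_self, pow_zero, one_mul]
  linarith

lemma SurjAt.rk_colon [GradedAlgebra 𝒜] (hC : SurjAt 𝒜 V L h r a) {c : ℕ} (hc : b₀ ≤ c) :
    rk (𝒜 c) - rk (𝒜 c ⊓ ((Ideal.span (L : Set S)).colon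
      (Ideal.span (V : Set S))).restrictScalars k) = defect V L (𝒜 c) 1 := by
  have hL := fg_of_le hV hLV
  have h1 := rk_sup_map_add (hfg c) (hL.mul (hfg c)) (LinearMap.mulLeft k h)
  have h2 : L * 𝒜 c ⊔ (𝒜 c).map (LinearMap.mulLeft k h) = V * 𝒜 c := by
    rw [← span_singleton_mul_eq_map]
    refine le_antisymm (sup_le (mul_le_mul' hLV le_rfl) (mul_le_mul' (by simpa using hh) le_rfl)) ?_
    obtain ⟨e, rfl⟩ := Nat.exists_eq_add_of_le' (show r ≤ c by omega)
    refine (hC.mono hstd (b := e) (by omega)).trans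
      (sup_le_sup le_rfl (mul_le_mul' le_rfl ?_))
    rw [add_comm e, ← grade_mul hstd]
    exact mul_le_mul' hVr le_rfl
  have h3 : 𝒜 c ⊓ (L * 𝒜 c).comap (LinearMap.mulLeft k h) =
      𝒜 c ⊓ ((Ideal.span (L : Set S)).colon (Ideal.span (V : Set S))).restrictScalars k := by
    ext s
    refine and_congr_right fun hs => ⟨fun hhs => ?_, fun hsc => ?_⟩
    · have hhs : h * s ∈ L * 𝒜 c := hhs
      refine Submodule.mem_colon.2 fun p hp => ?_
      induction hp using Submodule.span_induction with
      | mem v hv =>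
        rw [smul_eq_mul, mul_comm]
        refine mem_ideal_span_of_mem_mul (hC.mem_of_mul_mem hstd hfg hVr hV hLV hh (by omega)
          (hst c hc) (Submodule.mul_mem_mul hv hs) ?_)
        rw [mul_left_comm, add_comm c, ← grade_mul hstd, mul_left_comm]
        exact Submodule.mul_mem_mul (hVr hv) hhs
      | zero => simp
      | add x y _ _ hx hy => rw [smul_add]; exact add_mem hx hy
      | smul t y _ hy => rw [smul_comm]; exact Ideal.mul_mem_left _ _ hy
    · have h4 : s * h ∈ Ideal.span (L : Set S) :=
        Submodule.mem_colon.1 hsc h (Ideal.subset_span hh)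
      rw [mul_comm] at h4
      refine mem_mul_of_mem_span (hLV.trans hVr) h4 ?_
      rw [← grade_mul hstd]
      exact Submodule.mul_mem_mul (hVr hh) hs
  rw [h2, h3] at h1
  simp only [defect, pow_one, Nat.sub_self, pow_zero, one_mul]
  linarith

end Stabilization

section FilterRegular

variable {k S : Type*} [Field k] [CommRing S] [Algebra k S] {𝒜 : ℕ → Submodule k S}

/-- `g` is a nonzerodivisor in large degrees of the Rees algebra of `(V)` modulo `L`. -/
def FilterReg (𝒜 : ℕ → Submodule k S) (V L : Submodule k S) (g : S) : Prop :=
  ∃ n₀, ∀ n, n₀ ≤ n → ∀ b, ∀ x ∈ V ^ n * 𝒜 b,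
    g * x ∈ L * (V ^ n * 𝒜 b) → x ∈ L * (V ^ (n - 1) * 𝒜 b)

/-- Each member of the sequence is filter-regular modulo the previous ones. -/
def FilterRegSeq (𝒜 : ℕ → Submodule k S) (V : Submodule k S) : (i : ℕ) → (Fin i → S) → Prop
  | 0, _ => True
  | i + 1, f => FilterRegSeq 𝒜 V i (Fin.init f) ∧
      FilterReg 𝒜 V (Submodule.span k (Set.range (Fin.init f))) (f (Fin.last i))

variable {V L : Submodule k S} (hfg : ∀ n, (𝒜 n).FG) (hV : V.FG)

include hfg hV

lemma FilterReg.eventually_defect_succ_eq (hLV : L ≤ V) {g : S} (hg : g ∈ V)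
    (h : FilterReg 𝒜 V L g) (b : ℕ) : ∀ᶠ n in atTop, defect V L (𝒜 b) (n + 1) =
      defect V L (𝒜 b) n + defect V (L ⊔ Submodule.span k {g}) (𝒜 b) (n + 1) := by
  obtain ⟨n₀, hn₀⟩ := h
  filter_upwards [eventually_ge_atTop n₀, eventually_ge_atTop 1] with n hn hn1
  exact defect_succ_eq hV hLV (fg_of_le hV hLV) (hfg b) hg hn1 (hn₀ n hn b)

lemma growthLE_neg_rk {i : ℕ} (f : Fin i → S) (hf : ∀ j, f j ∈ V)
    (hreg : FilterRegSeq 𝒜 V i f) {b j : ℕ} {δ : ℝ}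
    (h : GrowthLE (fun n => -defect V (Submodule.span k (Set.range f)) (𝒜 b) n) j (-δ)) :
    GrowthLE (fun n => -rk (V ^ n * 𝒜 b)) (j + i) (-δ) := by
  induction i generalizing j with
  | zero =>
    refine h.mono (Eventually.of_forall fun n => ?_)
    simp [Set.range_eq_empty, defect_bot]
  | succ i ih =>
    rw [add_comm i, ← add_assoc]
    refine ih (Fin.init f) (fun j => hf _) hreg.1 (h.step ?_)
    filter_upwards [hreg.2.eventually_defect_succ_eq hfg hV
      (span_range_le (f := Fin.init f) fun j => hf _) (hf _) b] with n hn
    rw [span_range_snoc k f, hn]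
    linarith

omit hfg hV in
lemma defect_nonneg (hV : V.FG) {X : Submodule k S} (hX : X.FG) (hLV : L ≤ V) {n : ℕ}
    (hn : 1 ≤ n) : 0 ≤ defect V L X n := by
  obtain ⟨n, rfl⟩ := Nat.exists_eq_add_of_le' hn
  refine sub_nonneg.2 (rk_mono ((hV.pow _).mul hX) ?_)
  rw [Nat.add_sub_cancel, pow_succ', mul_assoc]
  exact mul_le_mul' hLV le_rfl

lemma FilterRegSeq.eventually_convex {g : Fin 2 → S} (hg : ∀ j, g j ∈ V)
    (hreg : FilterRegSeq 𝒜 V 2 g) (b : ℕ) :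
    (∀ᶠ n in atTop, rk (V ^ n * 𝒜 b) ≤ rk (V ^ (n + 1) * 𝒜 b)) ∧
    ∀ᶠ n in atTop, rk (V ^ (n + 1) * 𝒜 b) - rk (V ^ n * 𝒜 b) ≤
      rk (V ^ (n + 2) * 𝒜 b) - rk (V ^ (n + 1) * 𝒜 b) := by
  obtain ⟨⟨-, h1⟩, h2⟩ := hreg
  set g' := Fin.init g
  have h1 := h1.eventually_defect_succ_eq (g := g' (Fin.last 0)) hfg hV (span_range_le (f := Fin.init g') fun j => hg _) (hg _)
    b
  have h2 := h2.eventually_defect_succ_eq hfg hV (span_range_le (f := g') fun j => hg _) (hg _)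
    b
  have hb : Submodule.span k (Set.range (Fin.init g')) = ⊥ := by
    rw [Set.range_eq_empty, Submodule.span_empty]
  rw [← span_range_snoc k g', hb] at h1
  rw [← span_range_snoc k g] at h2
  simp only [defect_bot] at h1
  have hn1 : ∀ n, 0 ≤ defect V (Submodule.span k (Set.range g')) (𝒜 b) (n + 1) := fun n =>
    defect_nonneg hV (hfg b) (span_range_le fun j => hg _) (by omega)
  have hn2 : ∀ n, 0 ≤ defect V (Submodule.span k (Set.range g)) (𝒜 b) (n + 1) := fun n =>
    defect_nonneg hV (hfg b) (span_range_le fun j => hg _) (by omega)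
  constructor
  · filter_upwards [h1] with n hn
    linarith [hn1 n]
  · filter_upwards [h1, (tendsto_add_atTop_nat 1).eventually h1,
      (tendsto_add_atTop_nat 1).eventually h2] with n hn hn' hn''
    rw [add_assoc] at hn' hn''
    norm_num at hn' hn''
    linarith [hn2 (n + 1)]

end FilterRegular

section Asymptotics

variable {k S : Type*} [Field k] [CommRing S] [Algebra k S] {𝒜 : ℕ → Submodule k S}
  (hstd : ∀ n : ℕ, 𝒜 n = 𝒜 1 ^ n) {V : Submodule k S} {h : S} {r a i : ℕ} {f : Fin i → S}
  (hfg : ∀ n, (𝒜 n).FG) (hVr : V ≤ 𝒜 r) (hV : V.FG) (hh : h ∈ V) (hf : ∀ j, f j ∈ V)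

include hstd hfg hVr hV hh hf

lemma SurjAt.growthLE_rk (hC : SurjAt 𝒜 V (Submodule.span k (Set.range f)) h r a) {b : ℕ}
    (hb : a + r ≤ b) : GrowthLE (fun n => rk (V ^ n * 𝒜 b)) i
      (defect V (Submodule.span k (Set.range f)) (𝒜 b) 1) := by
  have := growthLE_rk_of_defect hV (hfg b) f hf (.const (eventually_atTop.2 ⟨1, fun n hn =>
    hC.defect_le hstd hfg hVr hV (span_range_le hf) hh hb hn⟩))
  rwa [zero_add] at this

lemma SurjAt.exists_tendsto (hC : SurjAt 𝒜 V (Submodule.span k (Set.range f)) h r a)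
    (hreg : FilterRegSeq 𝒜 V i f) :
    ∃ b₀, a + r ≤ b₀ ∧
      (∀ b, b₀ ≤ b → defect V (Submodule.span k (Set.range f)) (𝒜 (b + r)) 1 =
        defect V (Submodule.span k (Set.range f)) (𝒜 b) 1) ∧
      ∀ b, b₀ ≤ b → Tendsto (fun n : ℕ => (i.factorial : ℝ) / (n : ℝ) ^ i * rk (V ^ n * 𝒜 b))
        atTop (nhds (defect V (Submodule.span k (Set.range f)) (𝒜 b) 1)) := by
  obtain ⟨b₀, hab, hst⟩ := hC.exists_stable hstd hfg hVr hV (span_range_le hf) hh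
  refine ⟨b₀, hab, hst, fun b hb => ?_⟩
  refine (hC.growthLE_rk hstd hfg hVr hV hh hf (hab.trans hb)).tendsto ?_
  have := growthLE_neg_rk hfg hV f hf hreg (.const (eventually_atTop.2 ⟨1, fun n hn =>
    neg_le_neg (hC.le_defect hstd hfg hVr hV (span_range_le hf) hh hab hst hb hn)⟩))
  rwa [zero_add] at this

omit hh hf in
lemma isBigO_rk {b₀ : ℕ} {m : ℕ → ℝ} (hr : 0 < r)
    (hm : ∀ b, b₀ ≤ b → Tendsto
      (fun n : ℕ => (i.factorial : ℝ) / (n : ℝ) ^ i * rk (V ^ n * 𝒜 b)) atTop (nhds (m b)))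
    (b : ℕ) : (fun n => rk (V ^ n * 𝒜 b)) =O[atTop] (fun n : ℕ => (n : ℝ) ^ i) := by
  have hs : b₀ ≤ b₀ * r + b := by nlinarith
  obtain ⟨C, hC⟩ := (hm _ hs).norm.bddAbove_range
  refine Asymptotics.IsBigO.of_bound C (eventually_atTop.2 ⟨b₀ + 1, fun n hn => ?_⟩)
  obtain ⟨c, rfl⟩ := Nat.exists_eq_add_of_le' hn
  rw [Real.norm_of_nonneg (rk_nonneg _), Real.norm_of_nonneg (by positivity)]
  set e := c + 1 with he
  have h1 : rk (V ^ (e + b₀) * 𝒜 b) ≤ rk (V ^ e * 𝒜 (b₀ * r + b)) := by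
    refine rk_mono ((hV.pow _).mul (hfg _)) ?_
    rw [pow_add, mul_assoc]
    refine mul_le_mul' le_rfl ?_
    rw [mul_comm b₀]
    exact pow_mul_le_grade hstd hVr b₀ b
  have h2 := hC (Set.mem_range_self e)
  have he0 : (0 : ℝ) < (e : ℝ) ^ i := by positivity
  have hi : (1 : ℝ) ≤ i.factorial := by exact_mod_cast Nat.factorial_pos i
  have h3 : rk (V ^ e * 𝒜 (b₀ * r + b)) ≤ C * (e : ℝ) ^ i := by
    simp only [norm_mul, norm_div, Real.norm_of_nonneg (rk_nonneg _)] at h2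
    rw [Real.norm_of_nonneg (by positivity), Real.norm_of_nonneg (by positivity),
      div_mul_eq_mul_div, div_le_iff₀ he0] at h2
    nlinarith [rk_nonneg (V ^ e * 𝒜 (b₀ * r + b))]
  have hC0 : 0 ≤ C := (norm_nonneg _).trans h2
  have he' : c + (b₀ + 1) = e + b₀ := by omega
  rw [he']
  calc _ ≤ C * (e : ℝ) ^ i := h1.trans h3
    _ ≤ C * ((e + b₀ : ℕ) : ℝ) ^ i := by gcongr; omega

omit hh hf in
lemma tendsto_rk_diff {b₀ : ℕ} {m : ℕ → ℝ} (hr : 0 < r)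
    (hm : ∀ b, b₀ ≤ b → Tendsto
      (fun n : ℕ => (i.factorial : ℝ) / (n : ℝ) ^ i * rk (V ^ n * 𝒜 b)) atTop (nhds (m b)))
    {g : Fin 2 → S} (hg : ∀ j, g j ∈ V) (hreg : FilterRegSeq 𝒜 V 2 g) (b : ℕ) :
    Tendsto (fun n : ℕ => (i.factorial : ℝ) / (n : ℝ) ^ i *
      (rk (V ^ (n + 1) * 𝒜 b) - rk (V ^ n * 𝒜 b))) atTop (nhds 0) := by
  obtain ⟨h1, h2⟩ := hreg.eventually_convex hfg hV hg b
  exact tendsto_diff_of_convex (u := fun n => rk (V ^ n * 𝒜 b)) _ (fun n => rk_nonneg _) h1 h2 (isBigO_rk hstd hfg hVr hV hr hm b)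

end Asymptotics

section Length

variable {k R : Type*} [Field k] [CommRing R] [Algebra k R]

lemma mLength_eq_length (M : Type*) [AddCommGroup M] [Module R M] :
    mLength R M = Module.length R M :=
  (Module.length_eq_height R M).symm

lemma length_eq_of_residue_of_smul_eq_zero {𝔪 : Ideal R}
    (hres : ∀ x : R, ∃ c : k, x - algebraMap k R c ∈ 𝔪)
    {M : Type*} [AddCommGroup M] [Module R M] [Module k M] [IsScalarTower k R M]
    (h : ∀ x ∈ 𝔪, ∀ m : M, x • m = 0) : Module.length R M = Module.length k M := by
  let e : Submodule R M ≃o Submodule k M :=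
    { toFun := Submodule.restrictScalars k
      invFun := fun p =>
        { carrier := p
          add_mem' := p.add_mem
          zero_mem' := p.zero_mem
          smul_mem' := fun x m hm => by
            obtain ⟨c, hc⟩ := hres x
            have := h _ hc m
            rw [sub_smul, sub_eq_zero, algebraMap_smul] at this
            rw [this]
            exact p.smul_mem c hm }
      left_inv := fun p => rfl
      right_inv := fun p => rfl
      map_rel_iff' := Iff.rfl }
  rw [Module.length_eq_height, Module.length_eq_height, ← OrderIso.map_top e, Order.height_orderIso]

lemma length_eq_of_residue_of_pow_smul_eq_zero {𝔪 : Ideal R}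
    (hres : ∀ x : R, ∃ c : k, x - algebraMap k R c ∈ 𝔪) (N : ℕ) :
    ∀ (M : Type*) [AddCommGroup M] [Module R M] [Module k M] [IsScalarTower k R M],
      (∀ x ∈ 𝔪 ^ N, ∀ m : M, x • m = 0) → Module.length R M = Module.length k M := by
  induction N with
  | zero =>
    intro M _ _ _ _ h
    have : Subsingleton M := subsingleton_of_forall_eq 0 fun m => by
      simpa using h 1 (by simp) m
    rw [Module.length_eq_zero, Module.length_eq_zero]
  | succ N ih =>
    intro M _ _ _ _ h
    let M' : Submodule R M := 𝔪 • ⊤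
    have h1 : Module.length R M' = Module.length k M' := by
      apply ih
      rintro x hx ⟨m, hm⟩
      refine Subtype.ext ?_
      change x • m = 0
      induction hm using Submodule.smul_induction_on' with
      | smul y hy m hm =>
        rw [smul_smul]
        exact h _ (by rw [pow_succ]; exact Ideal.mul_mem_mul hx hy) _
      | add m _ m' _ hm hm' => rw [smul_add, hm, hm', add_zero]
    have h2 : Module.length R (M ⧸ M') = Module.length k (M ⧸ M') := by
      refine length_eq_of_residue_of_smul_eq_zero hres fun x hx m => ?_
      obtain ⟨m, rfl⟩ := M'.mkQ_surjective m
      rw [← map_smul, Submodule.mkQ_apply, Submodule.Quotient.mk_eq_zero]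
      exact Submodule.smul_mem_smul hx trivial
    rw [Module.length_eq_add_of_exact M'.subtype M'.mkQ M'.subtype_injective
        M'.mkQ_surjective (LinearMap.exact_subtype_mkQ M'), h1, h2]
    exact (Module.length_eq_add_of_exact (M'.subtype.restrictScalars k) (M'.mkQ.restrictScalars k)
        M'.subtype_injective M'.mkQ_surjective (LinearMap.exact_subtype_mkQ M')).symm

lemma toNat_length_eq_finrank (M : Type*) [AddCommGroup M] [Module k M] :
    (Module.length k M).toNat = Module.finrank k M := by
  rw [Module.length_eq_rank, Module.finrank, Cardinal.toNat_toENat]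

lemma toNat_mLength_eq_finrank {𝔪 : Ideal R}
    (hres : ∀ x : R, ∃ c : k, x - algebraMap k R c ∈ 𝔪) {N : ℕ}
    {M : Type*} [AddCommGroup M] [Module R M] [Module k M] [IsScalarTower k R M]
    (h : ∀ x ∈ 𝔪 ^ N, ∀ m : M, x • m = 0) : (mLength R M).toNat = Module.finrank k M := by
  rw [mLength_eq_length, length_eq_of_residue_of_pow_smul_eq_zero hres N M h,
    toNat_length_eq_finrank]

end Length

section HilbertSamuel

variable {k S : Type*} [Field k] [CommRing S] [Algebra k S] {𝒜 : ℕ → Submodule k S}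
  [GradedAlgebra 𝒜] (hstd : ∀ n : ℕ, 𝒜 n = 𝒜 1 ^ n)

lemma finrank_eq_of_ker_eq {M N P : Type*} [AddCommGroup M] [Module k M] [AddCommGroup N]
    [Module k N] [AddCommGroup P] [Module k P] {φ : M →ₗ[k] N} {ψ : M →ₗ[k] P}
    (hφ : Function.Surjective φ) (hψ : Function.Surjective ψ)
    (h : LinearMap.ker φ = LinearMap.ker ψ) : Module.finrank k N = Module.finrank k P := by
  rw [← (φ.quotKerEquivOfSurjective hφ).finrank_eq, ← (ψ.quotKerEquivOfSurjective hψ).finrank_eq,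
    h]

include hstd

lemma exists_sub_algebraMap_mem_gPlus (x : S) : ∃ c : k, x - algebraMap k S c ∈ gPlus 𝒜 := by
  have h0 := proj_mem 𝒜 0 x
  rw [grade_zero hstd] at h0
  obtain ⟨c, hc⟩ := Submodule.mem_one.1 h0
  refine ⟨c, ?_⟩
  rw [← pow_one (gPlus 𝒜), mem_gPlus_pow_iff hstd]
  intro e he
  obtain rfl : e = 0 := by omega
  rw [map_sub, hc, sub_eq_zero]
  exact (proj_eq_self (proj_mem 𝒜 0 x)).symm

lemma finrank_quotient_gPlus_pow (hfg : ∀ n, (𝒜 n).FG) {Q : Ideal S}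
    (hQ : ∀ q ∈ Q, ∀ c, GradedAlgebra.proj 𝒜 c q ∈ Q) (n : ℕ) :
    (Module.finrank k ((S ⧸ Q) ⧸ (gPlus 𝒜 ^ n • ⊤ : Submodule S (S ⧸ Q))) : ℝ) =
      ∑ c ∈ Finset.range n, (rk (𝒜 c) - rk (𝒜 c ⊓ Q.restrictScalars k)) := by
  let π : S →ₗ[k] S ⧸ Q := (Submodule.mkQ Q).restrictScalars k
  let φ : S →ₗ[k] (S ⧸ Q) ⧸ (gPlus 𝒜 ^ n • ⊤ : Submodule S (S ⧸ Q)) :=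
    ((Submodule.mkQ (gPlus 𝒜 ^ n • ⊤ : Submodule S (S ⧸ Q))).restrictScalars k).comp π
  let ψ : S →ₗ[k] (c : Fin n) → ↥((𝒜 c).map π) :=
    LinearMap.pi fun c => (π.comp (GradedAlgebra.proj 𝒜 c)).codRestrict _
      fun y => ⟨_, proj_mem 𝒜 c y, rfl⟩
  have hφ : Function.Surjective φ := by
    intro z
    obtain ⟨z, rfl⟩ := Submodule.mkQ_surjective _ z
    obtain ⟨z, rfl⟩ := Submodule.mkQ_surjective _ z
    exact ⟨z, rfl⟩
  have hψ : Function.Surjective ψ := by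
    intro w
    choose a ha hw using fun c => (w c).2
    refine ⟨∑ c, a c, funext fun c => Subtype.ext ?_⟩
    change π (GradedAlgebra.proj 𝒜 c (∑ e, a e)) = _
    rw [map_sum, Finset.sum_eq_single c, proj_eq_self (ha c), hw]
    · intro e _ he
      exact proj_eq_zero (ha e) (by simpa [Fin.ext_iff] using he)
    · simp
  have hker : LinearMap.ker φ = LinearMap.ker ψ := by
    ext y
    have h1 : y ∈ LinearMap.ker ψ ↔ ∀ c : Fin n, GradedAlgebra.proj 𝒜 c y ∈ Q := by
      rw [LinearMap.mem_ker, funext_iff]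
      refine forall_congr' fun c => ?_
      rw [← Subtype.coe_inj]
      exact Submodule.Quotient.mk_eq_zero Q
    have h2 : y ∈ LinearMap.ker φ ↔ y ∈ Q ⊔ gPlus 𝒜 ^ n := by
      rw [LinearMap.mem_ker]
      refine (Submodule.Quotient.mk_eq_zero _).trans ?_
      have : (gPlus 𝒜 ^ n • ⊤ : Submodule S (S ⧸ Q)) =
          Submodule.map Q.mkQ (gPlus 𝒜 ^ n) := by
        rw [← (LinearMap.range_eq_top.2 Q.mkQ_surjective), LinearMap.range_eq_map,
          ← Submodule.map_smul'', smul_eq_mul, Ideal.mul_top]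
      rw [this]
      rw [← Submodule.comap_map_mkQ]
      exact Iff.rfl
    rw [h1, h2]
    constructor
    · intro h c
      obtain ⟨q, hq, z, hz, rfl⟩ := Submodule.mem_sup.1 h
      rw [map_add, (mem_gPlus_pow_iff hstd).1 hz c c.2, add_zero]
      exact hQ q hq c
    · intro h
      refine mem_ideal_of_proj_mem (𝒜 := 𝒜) fun c => ?_
      by_cases hc : c < n
      · exact Ideal.mem_sup_left (h ⟨c, hc⟩)
      · exact Ideal.mem_sup_right (grade_le_gPlus_pow hstd (not_lt.1 hc) (proj_mem 𝒜 _ _))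
  have hfin : ∀ c : Fin n, Module.Finite k ↥((𝒜 c).map π) := fun c =>
    Module.Finite.iff_fg.2 ((hfg c).map π)
  rw [finrank_eq_of_ker_eq hφ hψ hker, Module.finrank_pi_fintype, Nat.cast_sum,
    ← Fin.sum_univ_eq_sum_range (fun c => rk (𝒜 c) - rk (𝒜 c ⊓ Q.restrictScalars k))]
  refine Finset.sum_congr rfl fun c _ => ?_
  rw [eq_sub_iff_add_eq, ← rk_map_add_rk_inf_ker (hfg c) π]
  congr 3
  ext y
  exact (Submodule.Quotient.mk_eq_zero Q).symm

lemma hsMult_eq_average (hfg : ∀ n, (𝒜 n).FG) {Q : Ideal S}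
    (hQ : ∀ q ∈ Q, ∀ c, GradedAlgebra.proj 𝒜 c q ∈ Q) {r b₀ : ℕ} (hr : 0 < r) {q : ℕ → ℝ}
    (hq : ∀ c, b₀ ≤ c → rk (𝒜 c) - rk (𝒜 c ⊓ Q.restrictScalars k) = q c)
    (hper : ∀ c, b₀ ≤ c → q (c + r) = q c) :
    hsMult (gPlus 𝒜) (S ⧸ Q) 1 = (∑ i ∈ Finset.range r, q (b₀ + i)) / r := by
  have h := tendsto_average_of_periodic hr
    (q := fun c => rk (𝒜 c) - rk (𝒜 c ⊓ Q.restrictScalars k)) (b₀ := b₀) fun c hc => by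
      rw [hq c hc, hq (c + r) (by omega), hper c hc]
  rw [Finset.sum_congr rfl fun i _ => hq (b₀ + i) (by omega)] at h
  refine Tendsto.limUnder_eq (h.congr fun n => ?_)
  rw [toNat_mLength_eq_finrank (k := k) (exists_sub_algebraMap_mem_gPlus hstd) (N := n),
    finrank_quotient_gPlus_pow hstd hfg hQ]
  · simp
  · intro x hx m
    obtain ⟨m, rfl⟩ := Submodule.mkQ_surjective _ m
    rw [← map_smul, Submodule.mkQ_apply, Submodule.Quotient.mk_eq_zero]
    exact Submodule.smul_mem_smul hx trivial

omit hstd in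
lemma proj_mem_colon_span {V L : Submodule k S} {r : ℕ} (hV : V ≤ 𝒜 r) (hL : L ≤ 𝒜 r) :
    ∀ q ∈ (Ideal.span (L : Set S)).colon (Ideal.span (V : Set S) : Set S), ∀ c,
      GradedAlgebra.proj 𝒜 c q ∈ (Ideal.span (L : Set S)).colon (Ideal.span (V : Set S) : Set S) := by
  intro q hq c
  rw [Submodule.mem_colon] at hq ⊢
  intro v hv
  induction hv using Submodule.span_induction with
  | mem v hv =>
    have h1 := proj_mem_mul_of_mem_span (𝒜 := 𝒜) hL (hq v (Ideal.subset_span hv)) c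
    rw [smul_eq_mul, mul_comm q v, proj_mul (hV hv)] at h1
    rw [smul_eq_mul, mul_comm]
    exact mem_ideal_span_of_mem_mul h1
  | zero => simp
  | add x y _ _ hx hy => rw [smul_add]; exact add_mem hx hy
  | smul a x _ hx => rw [smul_comm]; exact Ideal.mul_mem_left _ a hx

end HilbertSamuel

section Semicontinuity

variable {k : Type*} [Field k]

open MvPolynomial in
/-- The rank of a finite family depending affinely on parameters is lower semicontinuous. -/
lemma exists_polynomial_rk_span_le {W σ ι : Type*} [AddCommGroup W] [Module k W] [Fintype σ]
    [Finite ι] (u : ι → W) (v : ι → σ → W) (c₀ : σ → k) :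
    ∃ F : MvPolynomial σ k, eval c₀ F ≠ 0 ∧ ∀ c, eval c F ≠ 0 →
      rk (Submodule.span k (Set.range fun t => u t + ∑ p, c₀ p • v t p)) ≤
        rk (Submodule.span k (Set.range fun t => u t + ∑ p, c p • v t p)) := by
  classical
  set w : (σ → k) → ι → W := fun c t => u t + ∑ p, c p • v t p
  have hfin : ∀ c, Module.Finite k (Submodule.span k (Set.range (w c))) := fun c =>
    Module.Finite.iff_fg.2 (Submodule.fg_span (Set.finite_range _))
  have := hfin c₀
  obtain ⟨ρ, hρ, f, hf, hli⟩ : ∃ ρ, Module.finrank k (Submodule.span k (Set.range (w c₀))) = ρ ∧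
      ∃ f : Fin ρ → W, (∀ a, f a ∈ Set.range (w c₀)) ∧ LinearIndependent k f := by
    obtain ⟨f, hf, -, hli⟩ := Submodule.exists_fun_fin_finrank_span_eq k (Set.range (w c₀))
    exact ⟨_, rfl, f, hf, hli⟩
  choose s hs using hf
  obtain ⟨g, hg⟩ := LinearMap.exists_leftInverse_of_injective
    (Fintype.linearCombination k f)
    (LinearMap.ker_eq_bot.2 (linearIndependent_iff_injective_fintypeLinearCombination.1 hli))
  let A : Matrix (Fin ρ) (Fin ρ) (MvPolynomial σ k) := fun a b =>
    C (g (u (s a)) b) + ∑ p, X p * C (g (v (s a) p) b)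
  have hA : ∀ c, (A.map (eval c)) = fun a b => g (w c (s a)) b := by
    intro c
    ext a b
    rw [Matrix.map_apply]
    simp [A, w, map_sum, Finset.sum_apply]
  refine ⟨A.det, ?_, fun c hc => ?_⟩
  · rw [RingHom.map_det, RingHom.mapMatrix_apply, hA]
    have : (fun a b => g (w c₀ (s a)) b) = (1 : Matrix (Fin ρ) (Fin ρ) k) := by
      ext a b
      have h1 := LinearMap.congr_fun hg (Pi.single a 1)
      rw [LinearMap.comp_apply, Fintype.linearCombination_apply_single, one_smul, ← hs a] at h1
      rw [h1, LinearMap.id_apply, Matrix.one_apply, Pi.single_apply]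
      simp [eq_comm]
    rw [this, Matrix.det_one]
    exact one_ne_zero
  · rw [RingHom.map_det, RingHom.mapMatrix_apply, hA] at hc
    have h1 : LinearIndependent k (fun a => g (w c (s a))) :=
      Matrix.linearIndependent_rows_of_det_ne_zero hc
    have h2 : LinearIndependent k (fun a => w c (s a)) := LinearIndependent.of_comp g h1
    have h3 := finrank_span_eq_card h2
    rw [Fintype.card_fin] at h3
    have := hfin c
    refine Nat.cast_le.2 ((hρ.trans h3.symm).le.trans (Submodule.finrank_mono (Submodule.span_mono ?_)))
    rintro _ ⟨a, rfl⟩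
    exact ⟨s a, rfl⟩

variable {S : Type*} [CommRing S] [Algebra k S]

/-- The linear combinations of a finite family with prescribed coefficients. -/
def linComb {i m : ℕ} (x : Fin m → S) (c : Fin i × Fin m → k) : Fin i → S :=
  fun j => ∑ l, c (j, l) • x l

lemma exists_polynomial_rk_le {i m : ℕ} (x : Fin m → S) {Y Z : Submodule k S} (hY : Y.FG)
    (hZ : Z.FG) (c₀ : Fin i × Fin m → k) :
    ∃ F : MvPolynomial (Fin i × Fin m) k, MvPolynomial.eval c₀ F ≠ 0 ∧
      ∀ c, MvPolynomial.eval c F ≠ 0 →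
        rk (Submodule.span k (Set.range (linComb x c₀)) * Y ⊔ Z) ≤
          rk (Submodule.span k (Set.range (linComb x c)) * Y ⊔ Z) := by
  classical
  obtain ⟨p, y, rfl⟩ := Submodule.fg_iff_exists_fin_generating_family.1 hY
  obtain ⟨q, z, rfl⟩ := Submodule.fg_iff_exists_fin_generating_family.1 hZ
  obtain ⟨F, hF, hle⟩ := exists_polynomial_rk_span_le
    (Sum.elim (fun _ : Fin i × Fin p => (0 : S)) z)
    (Sum.elim (fun (t : Fin i × Fin p) (e : Fin i × Fin m) =>
      if e.1 = t.1 then x e.2 * y t.2 else 0) fun _ _ => 0) c₀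
  refine ⟨F, hF, fun c hc => ?_⟩
  have key : ∀ c : Fin i × Fin m → k,
      Submodule.span k (Set.range (linComb x c)) * Submodule.span k (Set.range y) ⊔
        Submodule.span k (Set.range z) =
      Submodule.span k (Set.range fun t : (Fin i × Fin p) ⊕ Fin q =>
        Sum.elim (fun _ : Fin i × Fin p => (0 : S)) z t + ∑ e, c e •
          Sum.elim (fun (t : Fin i × Fin p) (e : Fin i × Fin m) =>
            if e.1 = t.1 then x e.2 * y t.2 else 0) (fun _ _ => 0) t e) := by
    intro c
    rw [Submodule.span_mul_span, ← Submodule.span_union]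
    congr 1
    have h1 : ∀ (j : Fin i) (e : Fin p), (0 : S) + ∑ e' : Fin i × Fin m, c e' •
        (if e'.1 = j then x e'.2 * y e else 0) = linComb x c j * y e := by
      intro j e
      rw [zero_add, Fintype.sum_prod_type, Finset.sum_eq_single j]
      · simp [linComb, Finset.sum_mul]
      · intro b _ hb
        simp [hb]
      · simp
    ext t
    constructor
    · rintro (⟨_, ⟨j, rfl⟩, _, ⟨e, rfl⟩, rfl⟩ | ⟨e, rfl⟩)
      · exact ⟨Sum.inl (j, e), h1 j e⟩
      · exact ⟨Sum.inr e, by simp⟩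
    · rintro ⟨(⟨j, e⟩ | e), rfl⟩
      · exact Or.inl ⟨_, ⟨j, rfl⟩, _, ⟨e, rfl⟩, (h1 j e).symm⟩
      · exact Or.inr ⟨e, by simp⟩
  rw [key c₀, key c]
  exact hle c hc

end Semicontinuity

section UniformTorsion

variable {B : Type*} [CommRing B]

lemma mem_H0_iff {I : Ideal B} {M : Type*} [AddCommGroup M] [Module B M] {z : M} :
    z ∈ H0 I M ↔ ∃ e : ℕ, ∀ x ∈ I ^ e, x • z = 0 := by
  have hmono : Monotone fun n : ℕ => Submodule.torsionBySet B M ((I ^ n : Ideal B) : Set B) :=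
    fun a b hab => Submodule.torsionBySet_le_torsionBySet_of_subset (Ideal.pow_le_pow_right hab)
  rw [H0, Submodule.mem_iSup_of_directed _ hmono.directed_le]
  simp [Submodule.mem_torsionBySet_iff]

lemma exists_uniform_torsion [IsNoetherianRing B] (I : Ideal B) (M : Type*) [AddCommGroup M]
    [Module B M] [Module.Finite B M] :
    ∃ N : ℕ, ∀ z ∈ H0 I M, (∀ x ∈ I ^ N, x • z = 0) ∧
      (z ∈ (I ^ N • ⊤ : Submodule B M) → z = 0) := by
  have hmono : Monotone fun n : ℕ => Submodule.torsionBySet B M ((I ^ n : Ideal B) : Set B) :=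
    fun a b hab => Submodule.torsionBySet_le_torsionBySet_of_subset (Ideal.pow_le_pow_right hab)
  obtain ⟨N, hN⟩ := monotone_stabilizes_iff_noetherian.2 (inferInstance : IsNoetherian B M)
    ⟨_, hmono⟩
  obtain ⟨q, hq⟩ := Ideal.exists_pow_inf_eq_pow_smul I (H0 I M)
  have hkill : ∀ z ∈ H0 I M, ∀ x ∈ I ^ N, x • z = 0 := by
    intro z hz
    obtain ⟨e, he⟩ := mem_H0_iff.1 hz
    have h1 : z ∈ Submodule.torsionBySet B M ((I ^ (max N e) : Ideal B) : Set B) :=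
      hmono (le_max_right N e) (by simpa [Submodule.mem_torsionBySet_iff] using he)
    have h2 : Submodule.torsionBySet B M ((I ^ N : Ideal B) : Set B) =
      Submodule.torsionBySet B M ((I ^ (max N e) : Ideal B) : Set B) := hN _ (le_max_left N e)
    rw [← h2] at h1
    simpa [Submodule.mem_torsionBySet_iff] using h1
  refine ⟨q + N, fun z hz => ⟨fun x hx => hkill z hz x (Ideal.pow_le_pow_right le_add_self hx),
    fun hz' => ?_⟩⟩
  have h1 : z ∈ I ^ (q + N) • ⊤ ⊓ H0 I M := ⟨hz', hz⟩
  rw [hq _ le_self_add, Nat.add_sub_cancel_left] at h1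
  have h2 : I ^ N • (I ^ q • ⊤ ⊓ H0 I M) ≤ ⊥ := Submodule.smul_le.2 fun x hx y hy =>
    (Submodule.mem_bot B).2 (hkill y hy.2 x hx)
  exact (Submodule.mem_bot B).1 (h2 h1)

lemma exists_uniform_torsion_quotient [IsNoetherianRing B] (I K : Ideal B) :
    ∃ N : ℕ, ∀ z : B, (∃ e : ℕ, ∀ x ∈ I ^ e, x * z ∈ K) →
      (∀ x ∈ I ^ N, x * z ∈ K) ∧ (z ∈ I ^ N → z ∈ K) := by
  obtain ⟨N, hN⟩ := exists_uniform_torsion I (B ⧸ K)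
  have key : ∀ x z : B, x • K.mkQ z = 0 ↔ x * z ∈ K := fun x z => by
    rw [← map_smul, smul_eq_mul]
    exact Submodule.Quotient.mk_eq_zero K
  refine ⟨N, fun z ⟨e, he⟩ => ?_⟩
  obtain ⟨h2, h3⟩ := hN (K.mkQ z) (mem_H0_iff.2 ⟨e, fun x hx => (key x z).2 (he x hx)⟩)
  refine ⟨fun x hx => (key x z).1 (h2 x hx),
    fun h => (Submodule.Quotient.mk_eq_zero K).1 (h3 ?_)⟩
  have h5 := Submodule.smul_mem_smul h (Submodule.mem_top (x := K.mkQ (1 : B)))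
  rwa [← map_smul, smul_eq_mul, mul_one] at h5

variable (J : Ideal B)

/-- The extension of `J` to its Rees algebra, described by coefficients. -/
def reesShift : Ideal (reesAlgebra J) where
  carrier := {f | ∀ n, (f : Polynomial B).coeff n ∈ J ^ (n + 1)}
  add_mem' hf hg n := by
    simpa using add_mem (hf n) (hg n)
  zero_mem' n := by simp
  smul_mem' g f hf n := by
    rw [smul_eq_mul, Subalgebra.coe_mul, Polynomial.coeff_mul]
    refine sum_mem fun p hp => ?_
    rw [← Finset.HasAntidiagonal.mem_antidiagonal.1 hp, add_assoc, pow_add]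
    exact Ideal.mul_mem_mul ((mem_reesAlgebra_iff J _).1 g.2 _) (hf _)

/-- A homogeneous element of the Rees algebra. -/
def reesMonomial (n : ℕ) : ↥(J ^ n) →ₗ[B] reesAlgebra J where
  toFun y := ⟨Polynomial.monomial n (y : B), reesAlgebra.monomial_mem.2 y.2⟩
  map_add' x y := Subtype.ext (by simp)
  map_smul' x y := Subtype.ext (by simp [Polynomial.smul_monomial])

variable {J}

lemma reesMonomial_mem_reesShift {n : ℕ} {y : ↥(J ^ n)} :
    reesMonomial J n y ∈ reesShift J ↔ (y : B) ∈ J ^ (n + 1) := by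
  refine ⟨fun h => by simpa [reesMonomial] using h n, fun h m => ?_⟩
  by_cases hm : n = m
  · subst hm; simpa [reesMonomial] using h
  · simp [reesMonomial, Polynomial.coeff_monomial, hm]

lemma reesMonomial_mem_map {I : Ideal B} {n : ℕ} {y : ↥(J ^ n)} (hy : (y : B) ∈ I * J ^ n) :
    reesMonomial J n y ∈ I.map (algebraMap B (reesAlgebra J)) := by
  have : ∀ z ∈ I * J ^ n, ∃ hz : z ∈ J ^ n,
      reesMonomial J n ⟨z, hz⟩ ∈ I.map (algebraMap B (reesAlgebra J)) := by
    intro z hz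
    induction hz using Submodule.mul_induction_on' with
    | mem_mul_mem a ha b hb =>
      refine ⟨Ideal.mul_mem_left _ a hb, ?_⟩
      have h1 := map_smul (reesMonomial J n) a ⟨b, hb⟩
      rw [Algebra.smul_def] at h1
      exact h1 ▸ Ideal.mul_mem_right _ _ (Ideal.mem_map_of_mem _ ha)
    | add a _ b _ ha hb =>
      obtain ⟨ha, ha'⟩ := ha
      obtain ⟨hb, hb'⟩ := hb
      exact ⟨add_mem ha hb, (map_add (reesMonomial J n) ⟨a, ha⟩ ⟨b, hb⟩) ▸ add_mem ha' hb'⟩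
  exact (this y hy).2

lemma exists_uniform_torsion_gr [IsNoetherianRing B] (I J : Ideal B) :
    ∃ N : ℕ, ∀ n, ∀ y ∈ J ^ n, (∃ e, ∀ x ∈ I ^ e, x * y ∈ J ^ (n + 1)) →
      (∀ x ∈ I ^ N, x * y ∈ J ^ (n + 1)) ∧ (y ∈ I ^ N * J ^ n → y ∈ J ^ (n + 1)) := by
  obtain ⟨N, hN⟩ := exists_uniform_torsion_quotient (I.map (algebraMap B (reesAlgebra J)))
    (reesShift J)
  have key : ∀ (n : ℕ) (y : ↥(J ^ n)) (x : B), algebraMap B (reesAlgebra J) x *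
      reesMonomial J n y ∈ reesShift J ↔ x * (y : B) ∈ J ^ (n + 1) := by
    intro n y x
    rw [← Algebra.smul_def, ← map_smul]
    exact reesMonomial_mem_reesShift
  refine ⟨N, fun n y hy ⟨e, he⟩ => ?_⟩
  obtain ⟨h2, h3⟩ := hN (reesMonomial J n ⟨y, hy⟩) ⟨e, fun x hx => by
    rw [← Ideal.map_pow] at hx
    induction hx using Submodule.span_induction with
    | mem x hx =>
      obtain ⟨x, hx, rfl⟩ := hx
      exact (key n ⟨y, hy⟩ x).2 (he x hx)
    | zero => rw [zero_mul]; exact zero_mem _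
    | add x x' _ _ h h' => rw [add_mul]; exact add_mem h h'
    | smul a x _ h => rw [smul_eq_mul, mul_assoc]; exact Ideal.mul_mem_left _ _ h⟩
  rw [← Ideal.map_pow] at h2 h3
  exact ⟨fun x hx => (key n ⟨y, hy⟩ x).1 (h2 _ (Ideal.mem_map_of_mem _ hx)),
    fun h => reesMonomial_mem_reesShift (y := ⟨y, hy⟩).1
      (h3 (reesMonomial_mem_map (y := ⟨y, hy⟩) h))⟩

end UniformTorsion

section LocalLength

variable {k S : Type*} [Field k] [CommRing S] [Algebra k S] {𝒜 : ℕ → Submodule k S}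
  [GradedAlgebra 𝒜]

lemma proj_mem_span_of_mem {X : Submodule k S} {s : ℕ} (hX : X ≤ 𝒜 s) {y : S}
    (hy : y ∈ Ideal.span (X : Set S)) (c : ℕ) :
    GradedAlgebra.proj 𝒜 c y ∈ Ideal.span (X : Set S) := by
  by_cases hc : c < s
  · rw [proj_eq_zero_of_mem_span hX hy hc]; exact zero_mem _
  · obtain ⟨b, rfl⟩ := Nat.exists_eq_add_of_le (not_lt.1 hc)
    exact mem_ideal_span_of_mem_mul (proj_mem_mul_of_mem_span hX hy b)

variable (hstd : ∀ n : ℕ, 𝒜 n = 𝒜 1 ^ n)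

include hstd

lemma exists_mul_add_eq_one {s : S} (hs : s ∉ gPlus 𝒜) (e : ℕ) :
    ∃ s' : S, ∃ p ∈ gPlus 𝒜 ^ e, s' * s + p = 1 := by
  have h1 : IsCoprime (Ideal.span {s}) (gPlus 𝒜) := by
    rw [Ideal.isCoprime_iff_exists]
    obtain ⟨c, hc⟩ := exists_sub_algebraMap_mem_gPlus hstd s
    have hc0 : c ≠ 0 := by
      rintro rfl
      exact hs (by simpa using hc)
    refine ⟨algebraMap k S c⁻¹ * s, Ideal.mul_mem_left _ _ (Ideal.mem_span_singleton_self s),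
      algebraMap k S (-c⁻¹) * (s - algebraMap k S c), Ideal.mul_mem_left _ _ hc, ?_⟩
    have h2 : algebraMap k S c⁻¹ * algebraMap k S c = 1 := by
      rw [← map_mul, inv_mul_cancel₀ hc0, map_one]
    rw [map_neg]
    linear_combination h2
  obtain ⟨a, ha, p, hp, h⟩ := Ideal.isCoprime_iff_exists.1 (h1.pow_right (n := e))
  obtain ⟨s', rfl⟩ := Ideal.mem_span_singleton'.1 ha
  exact ⟨s', p, hp, h⟩

lemma mem_of_mul_mem_of_notMem_gPlus {K : Ideal S}
    (hK : ∀ q ∈ K, ∀ c, GradedAlgebra.proj 𝒜 c q ∈ K) {t w : S} (ht : t ∉ gPlus 𝒜)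
    (h : t * w ∈ K) : w ∈ K := by
  refine mem_ideal_of_proj_mem (𝒜 := 𝒜) fun b => ?_
  obtain ⟨s', p, hp, h1⟩ := exists_mul_add_eq_one hstd ht (b + 1)
  have h2 : w = s' * (t * w) + p * w := by linear_combination -w * h1
  rw [h2, map_add, (mem_gPlus_pow_iff hstd).1 (Ideal.mul_mem_right w _ hp) b (by omega), add_zero]
  exact hK _ (Ideal.mul_mem_left _ _ h) b

/-- The elements of `Jⁿ` that some power of `𝔫` multiplies into `J^{n+1}`. -/
def torsionPart (k : Type*) {S : Type*} [Field k] [CommRing S] [Algebra k S]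
    (𝔫 J : Ideal S) (n : ℕ) : Submodule k S where
  carrier := {y | y ∈ J ^ n ∧ ∃ e, ∀ x ∈ 𝔫 ^ e, x * y ∈ J ^ (n + 1)}
  zero_mem' := ⟨zero_mem _, 0, fun x _ => by simp⟩
  add_mem' := by
    rintro y z ⟨hy, e, he⟩ ⟨hz, e', he'⟩
    refine ⟨add_mem hy hz, max e e', fun x hx => ?_⟩
    rw [mul_add]
    exact add_mem (he x (Ideal.pow_le_pow_right (le_max_left _ _) hx))
      (he' x (Ideal.pow_le_pow_right (le_max_right _ _) hx))
  smul_mem' := by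
    rintro c y ⟨hy, e, he⟩
    refine ⟨Submodule.smul_of_tower_mem _ c hy, e, fun x hx => ?_⟩
    rw [mul_smul_comm]
    exact Submodule.smul_of_tower_mem _ c (he x hx)

variable [hprime : (gPlus 𝒜).IsPrime]

lemma algebraMap_mem_map_iff {K : Ideal S} (hK : ∀ q ∈ K, ∀ c, GradedAlgebra.proj 𝒜 c q ∈ K)
    {y : S} : algebraMap S (Localization.AtPrime (gPlus 𝒜)) y ∈
      K.map (algebraMap S (Localization.AtPrime (gPlus 𝒜))) ↔ y ∈ K := by
  refine ⟨fun h => ?_, fun h => Ideal.mem_map_of_mem _ h⟩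
  rw [IsLocalization.algebraMap_mem_map_algebraMap_iff (gPlus 𝒜).primeCompl] at h
  obtain ⟨t, ht, h⟩ := h
  exact mem_of_mul_mem_of_notMem_gPlus hstd hK ht h

lemma exists_sub_algebraMap_mem_maximalIdeal (x : Localization.AtPrime (gPlus 𝒜)) :
    ∃ c : k, x - algebraMap k (Localization.AtPrime (gPlus 𝒜)) c ∈
      IsLocalRing.maximalIdeal (Localization.AtPrime (gPlus 𝒜)) := by
  obtain ⟨a, s, rfl⟩ := IsLocalization.exists_mk'_eq (gPlus 𝒜).primeCompl x
  obtain ⟨s', p, hp, h1⟩ := exists_mul_add_eq_one hstd s.2 1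
  rw [pow_one] at hp
  obtain ⟨c, hc⟩ := exists_sub_algebraMap_mem_gPlus hstd (s' * a)
  refine ⟨c, ?_⟩
  rw [IsScalarTower.algebraMap_apply k S]
  set φ := algebraMap S (Localization.AtPrime (gPlus 𝒜))
  have h2 : ∀ z, z ∈ gPlus 𝒜 → φ z ∈ IsLocalRing.maximalIdeal (Localization.AtPrime (gPlus 𝒜)) :=
    fun z hz => (IsLocalization.AtPrime.to_map_mem_maximal_iff _ (gPlus 𝒜) z).2 hz
  have h3 := IsLocalization.mk'_spec (Localization.AtPrime (gPlus 𝒜)) a s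
  have h4 := congrArg φ h1
  rw [map_add, map_mul, map_one] at h4
  have h5 : IsLocalization.mk' (Localization.AtPrime (gPlus 𝒜)) a s - φ (algebraMap k S c) =
      φ (s' * a - algebraMap k S c) + IsLocalization.mk' (Localization.AtPrime (gPlus 𝒜)) a s *
        φ p := by
    rw [map_sub, map_mul, ← h3]
    linear_combination (-IsLocalization.mk' (Localization.AtPrime (gPlus 𝒜)) a s) * h4
  rw [h5]
  exact add_mem (h2 _ hc) (Ideal.mul_mem_left _ _ (h2 _ hp))

omit [GradedAlgebra 𝒜] hstd in
lemma mem_map_H0_gradedPiece_iff {A : Type*} [CommRing A] {𝔪 I : Ideal A} {n : ℕ} {a : A} :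
    (I ^ (n + 1) • ⊤ : Submodule A A).mkQ a ∈
      (H0 𝔪 (gradedPiece I (M := A) n)).map (gradedPiece I (M := A) n).subtype ↔
      a ∈ I ^ n ∧ ∃ e, ∀ x ∈ 𝔪 ^ e, x * a ∈ I ^ (n + 1) := by
  have h0 : ∀ b : A, (I ^ (n + 1) • ⊤ : Submodule A A).mkQ b = 0 ↔ b ∈ I ^ (n + 1) := fun b => by
    rw [Submodule.mkQ_apply, Submodule.Quotient.mk_eq_zero, smul_eq_mul, Ideal.mul_top]
  have h1 : (I ^ (n + 1) • ⊤ : Submodule A A).mkQ a ∈ gradedPiece I (M := A) n ↔ a ∈ I ^ n := by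
    constructor
    · rintro ⟨b, hb, hba⟩
      rw [smul_eq_mul, Ideal.mul_top] at hb
      rw [← sub_eq_zero, ← map_sub, h0] at hba
      have := sub_mem hb (Ideal.pow_le_pow_right (Nat.le_succ n) hba)
      rwa [sub_sub_cancel] at this
    · intro ha
      exact ⟨a, by rwa [smul_eq_mul, Ideal.mul_top], rfl⟩
  constructor
  · rintro ⟨z, hz, hza⟩
    obtain ⟨e, he⟩ := mem_H0_iff.1 hz
    refine ⟨h1.1 (hza ▸ z.2), e, fun x hx => ?_⟩
    rw [← h0, ← smul_eq_mul, map_smul, ← hza, ← map_smul, he x hx, map_zero]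
  · rintro ⟨ha, e, he⟩
    refine ⟨⟨_, h1.2 ha⟩, mem_H0_iff.2 ⟨e, fun x hx => Subtype.ext ?_⟩, rfl⟩
    have := (h0 _).2 (he x hx)
    rwa [← smul_eq_mul, map_smul] at this

omit hprime in
lemma proj_mem_pow {V : Submodule k S} {r : ℕ} (hV : V ≤ 𝒜 r) (n : ℕ) :
    ∀ q ∈ Ideal.span (V : Set S) ^ n, ∀ c,
      GradedAlgebra.proj 𝒜 c q ∈ Ideal.span (V : Set S) ^ n := by
  intro q hq c
  rw [← ideal_span_pow] at hq ⊢
  exact proj_mem_span_of_mem (pow_le_grade hstd hV n) hq c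

/-- The length of the torsion of a graded piece of `gr_I(R)` is the dimension of a graded
quotient. -/
lemma toNat_mLength_H0_eq_finrank [IsNoetherianRing S] {V : Submodule k S} {r : ℕ}
    (hV : V ≤ 𝒜 r) (n : ℕ) {P : Type*} [AddCommGroup P] [Module k P]
    {ψ : torsionPart k (gPlus 𝒜) (Ideal.span (V : Set S)) n →ₗ[k] P}
    (hψ : Function.Surjective ψ)
    (hker : ∀ y, ψ y = 0 ↔ (y : S) ∈ Ideal.span (V : Set S) ^ (n + 1)) :
    (mLength (Localization.AtPrime (gPlus 𝒜))
      (H0 (IsLocalRing.maximalIdeal (Localization.AtPrime (gPlus 𝒜)))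
        (gradedPiece ((Ideal.span (V : Set S)).map
          (algebraMap S (Localization.AtPrime (gPlus 𝒜))))
          (M := Localization.AtPrime (gPlus 𝒜)) n))).toNat = Module.finrank k P := by
  set J := Ideal.span (V : Set S) with hJ
  let A := Localization.AtPrime (gPlus 𝒜)
  let 𝔪 : Ideal A := IsLocalRing.maximalIdeal A
  let I : Ideal A := J.map (algebraMap S A)
  let Q := A ⧸ (I ^ (n + 1) • ⊤ : Submodule A A)
  let G : Submodule A Q := gradedPiece I (M := A) n
  have hmem : ∀ (e : ℕ) (y : S), algebraMap S A y ∈ I ^ e ↔ y ∈ J ^ e := fun e y => by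
    rw [← Ideal.map_pow]
    exact algebraMap_mem_map_iff hstd (proj_mem_pow hstd hV e)
  have h𝔪 : 𝔪 = (gPlus 𝒜).map (algebraMap S A) := (Localization.AtPrime.map_eq_maximalIdeal).symm
  obtain ⟨N, hN⟩ := exists_uniform_torsion 𝔪 G
  have h1 : (mLength A (H0 𝔪 G)).toNat = Module.finrank k (H0 𝔪 G) :=
    toNat_mLength_eq_finrank (exists_sub_algebraMap_mem_maximalIdeal hstd) (N := N)
      fun x hx z => Subtype.ext ((hN z z.2).1 x hx)
  have h2 : Module.finrank k (H0 𝔪 G) = Module.finrank k ((H0 𝔪 G).map G.subtype) :=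
    ((Submodule.equivMapOfInjective G.subtype G.subtype_injective
      (H0 𝔪 G)).restrictScalars k).finrank_eq
  let θ : S →ₗ[k] Q := ((Submodule.mkQ _).restrictScalars k).comp
    (IsScalarTower.toAlgHom k S A).toLinearMap
  have hθ : ∀ y : S, θ y = (I ^ (n + 1) • ⊤ : Submodule A A).mkQ (algebraMap S A y) :=
    fun _ => rfl
  have hmul : ∀ (y : S) (e : ℕ), (∀ x ∈ gPlus 𝒜 ^ e, x * y ∈ J ^ (n + 1)) →
      ∀ x ∈ 𝔪 ^ e, x * algebraMap S A y ∈ I ^ (n + 1) := by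
    intro y e he x hx
    rw [h𝔪, ← Ideal.map_pow] at hx
    induction hx using Submodule.span_induction with
    | mem x hx =>
      obtain ⟨x, hx, rfl⟩ := hx
      rw [← map_mul]
      exact (hmem _ _).2 (he x hx)
    | zero => rw [zero_mul]; exact zero_mem _
    | add x x' _ _ h h' => rw [add_mul]; exact add_mem h h'
    | smul a x _ h => rw [smul_eq_mul, mul_assoc]; exact Ideal.mul_mem_left _ _ h
  have hx𝔪 : ∀ (e : ℕ), ∀ x ∈ gPlus 𝒜 ^ e, algebraMap S A x ∈ 𝔪 ^ e := by
    intro e x hx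
    rw [h𝔪, ← Ideal.map_pow]
    exact Ideal.mem_map_of_mem _ hx
  have h3 : (torsionPart k (gPlus 𝒜) J n).map θ =
      ((H0 𝔪 G).map G.subtype).restrictScalars k := by
    ext z
    constructor
    · rintro ⟨y, ⟨hy, e, he⟩, rfl⟩
      exact mem_map_H0_gradedPiece_iff.2 ⟨(hmem _ _).2 hy, e, hmul y e he⟩
    · intro hz
      obtain ⟨a, rfl⟩ := Submodule.mkQ_surjective _ z
      obtain ⟨ha, e, he⟩ := mem_map_H0_gradedPiece_iff.1 hz
      rw [← Ideal.map_pow, IsLocalization.mem_map_algebraMap_iff (gPlus 𝒜).primeCompl] at ha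
      obtain ⟨⟨⟨y, hy⟩, s⟩, hs⟩ := ha
      dsimp only at hs
      obtain ⟨s', p, hp, h4⟩ := exists_mul_add_eq_one hstd s.2 e
      have h5 := congrArg (algebraMap S A) h4
      rw [map_add, map_mul, map_one] at h5
      refine ⟨s' * y, ⟨Ideal.mul_mem_left _ _ hy, e, fun x hx => ?_⟩, ?_⟩
      · rw [← hmem, map_mul, map_mul, ← hs]
        have := Ideal.mul_mem_left _ (algebraMap S A s' * algebraMap S A s)
          (he _ (hx𝔪 e x hx))
        convert this using 1
        ring
      · rw [hθ, ← sub_eq_zero, ← map_sub, Submodule.mkQ_apply, Submodule.Quotient.mk_eq_zero,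
          smul_eq_mul, Ideal.mul_top, map_mul, ← hs]
        have := neg_mem (he _ (hx𝔪 e p hp))
        convert this using 1
        linear_combination a * h5
  let θ' := θ.domRestrict (torsionPart k (gPlus 𝒜) J n)
  rw [h1, h2]
  have h6 : LinearMap.range θ' = ((H0 𝔪 G).map G.subtype).restrictScalars k := by
    rw [← h3]; exact LinearMap.range_domRestrict _ _
  refine Eq.trans ?_ (finrank_eq_of_ker_eq (φ := θ'.rangeRestrict)
    θ'.surjective_rangeRestrict hψ ?_)
  · rw [h6]; rfl
  · rw [LinearMap.ker_rangeRestrict]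
    ext y
    rw [LinearMap.mem_ker, LinearMap.mem_ker, hker]
    change θ y = 0 ↔ _
    rw [hθ, Submodule.mkQ_apply, Submodule.Quotient.mk_eq_zero, smul_eq_mul, Ideal.mul_top]
    exact hmem _ _

end LocalLength

section JMultiplicity

variable {k S : Type*} [Field k] [CommRing S] [Algebra k S]

lemma rk_le_rk_inf_add_sum {M N ι : Type*} [AddCommGroup M] [Module k M] [AddCommGroup N]
    [Module k N] {X : Submodule k M} (hX : X.FG) (φ : ι → M →ₗ[k] N) (s : Finset ι) :
    rk X ≤ rk (X ⊓ ⨅ e ∈ s, LinearMap.ker (φ e)) + ∑ e ∈ s, rk (X.map (φ e)) := by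
  classical
  induction s using Finset.induction_on with
  | empty => simp
  | insert e s he ih =>
    have hY := fg_of_le hX (inf_le_left (b := ⨅ e ∈ s, LinearMap.ker (φ e)))
    have h1 := rk_map_add_rk_inf_ker hY (φ e)
    have h2 : rk ((X ⊓ ⨅ e ∈ s, LinearMap.ker (φ e)).map (φ e)) ≤ rk (X.map (φ e)) :=
      rk_mono (hX.map _) (Submodule.map_mono inf_le_left)
    rw [Finset.iInf_insert, Finset.sum_insert he, inf_comm (LinearMap.ker (φ e)), ← inf_assoc]
    linarith

variable {𝒜 : ℕ → Submodule k S} [GradedAlgebra 𝒜] (hstd : ∀ n : ℕ, 𝒜 n = 𝒜 1 ^ n)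
  {V : Submodule k S} {r : ℕ}

include hstd

lemma mul_mem_of_mem_gPlus_pow {K : Ideal S} {e : ℕ} {y : S} (h : ∀ x ∈ 𝒜 e, x * y ∈ K) :
    ∀ x ∈ gPlus 𝒜 ^ e, x * y ∈ K := by
  intro x hx
  rw [gPlus_pow hstd] at hx
  induction hx using Submodule.span_induction with
  | mem x hx => exact h x hx
  | zero => rw [zero_mul]; exact zero_mem _
  | add x x' _ _ h h' => rw [add_mul]; exact add_mem h h'
  | smul a x _ h => rw [smul_eq_mul, mul_assoc]; exact Ideal.mul_mem_left _ _ h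

lemma span_pow_inf_grade (hVr : V ≤ 𝒜 r) (n b : ℕ) :
    (Ideal.span (V : Set S) ^ n).restrictScalars k ⊓ 𝒜 (r * n + b) = V ^ n * 𝒜 b := by
  ext y
  constructor
  · rintro ⟨hy, hy'⟩
    rw [SetLike.mem_coe, Submodule.restrictScalars_mem, ← ideal_span_pow] at hy
    exact mem_mul_of_mem_span (pow_le_grade hstd hVr n) hy hy'
  · intro hy
    refine ⟨?_, pow_mul_le_grade hstd hVr n b hy⟩
    rw [SetLike.mem_coe, Submodule.restrictScalars_mem, ← ideal_span_pow]
    exact mem_ideal_span_of_mem_mul hy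

lemma span_pow_succ_inf_grade_of_lt (hVr : V ≤ 𝒜 r) (n : ℕ) {b : ℕ} (hb : b < r) :
    (Ideal.span (V : Set S) ^ (n + 1)).restrictScalars k ⊓ 𝒜 (r * n + b) = ⊥ := by
  rw [eq_bot_iff]
  rintro y ⟨hy, hy'⟩
  rw [SetLike.mem_coe, Submodule.restrictScalars_mem, ← ideal_span_pow] at hy
  rw [Submodule.mem_bot, ← proj_eq_self hy']
  exact proj_eq_zero_of_mem_span (pow_le_grade hstd hVr (n + 1)) hy (by rw [mul_add]; omega)

lemma span_pow_succ_inf_grade (hVr : V ≤ 𝒜 r) (n b : ℕ) :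
    (Ideal.span (V : Set S) ^ (n + 1)).restrictScalars k ⊓ 𝒜 (r * n + (r + b)) =
      V ^ (n + 1) * 𝒜 b := by
  rw [← span_pow_inf_grade hstd hVr, mul_add, mul_one, add_assoc]

lemma proj_mem_torsionPart (hVr : V ≤ 𝒜 r) {n : ℕ} {y : S}
    (hy : y ∈ torsionPart k (gPlus 𝒜) (Ideal.span (V : Set S)) n) (c : ℕ) :
    GradedAlgebra.proj 𝒜 c y ∈ torsionPart k (gPlus 𝒜) (Ideal.span (V : Set S)) n := by
  obtain ⟨hy, e, he⟩ := hy
  refine ⟨proj_mem_pow hstd hVr n y hy c, e, mul_mem_of_mem_gPlus_pow hstd fun x hx => ?_⟩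
  rw [← proj_mul hx]
  exact proj_mem_pow hstd hVr (n + 1) _ (he x (grade_le_gPlus_pow hstd le_rfl hx)) _

/-- The length of the torsion of the `n`-th graded piece of `gr_I(R)`, as a sum over degrees. -/
lemma exists_toNat_mLength_H0_eq_sum [IsNoetherianRing S] [hprime : (gPlus 𝒜).IsPrime]
    (hfg : ∀ n, (𝒜 n).FG) (hVr : V ≤ 𝒜 r) :
    ∃ N : ℕ, (∀ n, ∀ y ∈ torsionPart k (gPlus 𝒜) (Ideal.span (V : Set S)) n,
      ∀ x ∈ gPlus 𝒜 ^ N, x * y ∈ Ideal.span (V : Set S) ^ (n + 1)) ∧ ∀ N', N ≤ N' → ∀ n,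
      ((mLength (Localization.AtPrime (gPlus 𝒜))
        (H0 (IsLocalRing.maximalIdeal (Localization.AtPrime (gPlus 𝒜)))
          (gradedPiece ((Ideal.span (V : Set S)).map
            (algebraMap S (Localization.AtPrime (gPlus 𝒜))))
            (M := Localization.AtPrime (gPlus 𝒜)) n))).toNat : ℝ) =
      ∑ b ∈ Finset.range N',
        (rk (torsionPart k (gPlus 𝒜) (Ideal.span (V : Set S)) n ⊓ 𝒜 (r * n + b)) -
          rk ((Ideal.span (V : Set S) ^ (n + 1)).restrictScalars k ⊓ 𝒜 (r * n + b))) := by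
  set J := Ideal.span (V : Set S) with hJ
  obtain ⟨N, hN⟩ := exists_uniform_torsion_gr (gPlus 𝒜) J
  refine ⟨N, fun n y hy => (hN n y hy.1 hy.2).1, fun N' hN' n => ?_⟩
  let T := torsionPart k (gPlus 𝒜) J n
  let π : S →ₗ[k] S ⧸ J ^ (n + 1) := (Submodule.mkQ (J ^ (n + 1))).restrictScalars k
  have hπ : ∀ y, π y = 0 ↔ y ∈ J ^ (n + 1) := fun y => Submodule.Quotient.mk_eq_zero _
  let ψ : T →ₗ[k] (b : Fin N') → ↥((T ⊓ 𝒜 (r * n + b)).map π) :=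
    LinearMap.pi fun b => ((π.comp (GradedAlgebra.proj 𝒜 (r * n + b))).domRestrict T).codRestrict _
      fun y => ⟨_, ⟨proj_mem_torsionPart hstd hVr y.2 _, proj_mem 𝒜 _ _⟩, rfl⟩
  have hψ : Function.Surjective ψ := by
    intro w
    choose a ha hw using fun b => (w b).2
    refine ⟨∑ b, ⟨a b, (ha b).1⟩, funext fun b => Subtype.ext ?_⟩
    change π (GradedAlgebra.proj 𝒜 (r * n + b) ((∑ e, ⟨a e, (ha e).1⟩ : T) : S)) = _
    rw [AddSubmonoidClass.coe_finsetSum, map_sum, Finset.sum_eq_single b,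
      proj_eq_self (ha b).2, hw]
    · intro e _ he
      exact proj_eq_zero (ha e).2 (by simpa [Fin.ext_iff] using he)
    · simp
  have hker : ∀ y, ψ y = 0 ↔ (y : S) ∈ J ^ (n + 1) := by
    intro y
    have h1 : ψ y = 0 ↔ ∀ b : Fin N', GradedAlgebra.proj 𝒜 (r * n + b) (y : S) ∈ J ^ (n + 1) := by
      rw [funext_iff]
      refine forall_congr' fun b => ?_
      rw [← Subtype.coe_inj]
      exact hπ _
    rw [h1]
    refine ⟨fun h => mem_ideal_of_proj_mem (𝒜 := 𝒜) fun c => ?_,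
      fun h b => proj_mem_pow hstd hVr _ _ h _⟩
    have hyn : (y : S) ∈ Ideal.span ((V ^ n : Submodule k S) : Set S) := by
      rw [ideal_span_pow]; exact y.2.1
    by_cases hc : c < r * n
    · rw [proj_eq_zero_of_mem_span (pow_le_grade hstd hVr n) hyn hc]
      exact zero_mem _
    obtain ⟨b, rfl⟩ := Nat.exists_eq_add_of_le (not_lt.1 hc)
    by_cases hb : b < N'
    · exact h ⟨b, hb⟩
    have h2 := proj_mem_torsionPart hstd hVr y.2 (r * n + b)
    refine (hN n _ h2.1 h2.2).2 ?_
    have h3 : ∀ z ∈ V ^ n * 𝒜 b, z ∈ J ^ n * gPlus 𝒜 ^ N := by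
      intro z hz
      refine Submodule.mul_induction_on hz (fun x hx z hz => ?_) fun x z hx hz => add_mem hx hz
      refine Ideal.mul_mem_mul ?_ (grade_le_gPlus_pow hstd (by omega) hz)
      rw [hJ, ← ideal_span_pow]
      exact Ideal.subset_span hx
    rw [mul_comm (gPlus 𝒜 ^ N)]
    exact h3 _ (proj_mem_mul_of_mem_span (pow_le_grade hstd hVr n) hyn b)
  have hfgT : ∀ b, (T ⊓ 𝒜 (r * n + b)).FG := fun b => fg_of_le (hfg _) inf_le_right
  have hfin : ∀ b : Fin N', Module.Finite k ↥((T ⊓ 𝒜 (r * n + b)).map π) := fun b =>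
    Module.Finite.iff_fg.2 ((hfgT b).map π)
  rw [toNat_mLength_H0_eq_finrank hstd hVr n hψ hker, Module.finrank_pi_fintype, Nat.cast_sum,
    ← Fin.sum_univ_eq_sum_range (fun b => rk (T ⊓ 𝒜 (r * n + b)) -
      rk ((J ^ (n + 1)).restrictScalars k ⊓ 𝒜 (r * n + b)))]
  refine Finset.sum_congr rfl fun b _ => ?_
  rw [eq_sub_iff_add_eq, ← rk_map_add_rk_inf_ker (hfgT b) π]
  have hinf : (J ^ (n + 1)).restrictScalars k ⊓ 𝒜 (r * n + b) =
      T ⊓ 𝒜 (r * n + b) ⊓ LinearMap.ker π := by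
    ext y
    constructor
    · rintro ⟨hy, hy'⟩
      exact ⟨⟨⟨Ideal.pow_le_pow_right (Nat.le_succ n) hy, 0,
        fun x _ => Ideal.mul_mem_left _ x hy⟩, hy'⟩, (hπ y).2 hy⟩
    · rintro ⟨⟨-, hy⟩, hy'⟩
      exact ⟨(hπ y).1 hy', hy⟩
  rw [hinf]
  rfl

end JMultiplicity

section JMultiplicityLimit

variable {k S : Type*} [Field k] [CommRing S] [Algebra k S]
  {𝒜 : ℕ → Submodule k S} [GradedAlgebra 𝒜] (hstd : ∀ n : ℕ, 𝒜 n = 𝒜 1 ^ n)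
  {V : Submodule k S} {r : ℕ}

include hstd

/-- The codimension of the torsion part of `V ^ n * 𝒜 b` is controlled by a difference of ranks in
larger degrees. -/
lemma exists_rk_sub_rk_torsionPart_le (hfg : ∀ n, (𝒜 n).FG) (hVr : V ≤ 𝒜 r) (b b₀ : ℕ) :
    ∃ p : ℕ, ∀ n, rk (V ^ n * 𝒜 b) -
        rk (torsionPart k (gPlus 𝒜) (Ideal.span (V : Set S)) n ⊓ 𝒜 (r * n + b)) ≤
      p * (rk (V ^ n * 𝒜 (b + b₀ + r)) - rk (V ^ (n + 1) * 𝒜 (b + b₀))) := by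
  obtain ⟨p, a, ha⟩ := Submodule.fg_iff_exists_fin_generating_family.1 (hfg (b₀ + r))
  refine ⟨p, fun n => ?_⟩
  set J := Ideal.span (V : Set S) with hJ
  have hVfg : V.FG := fg_of_le (hfg r) hVr
  let π : S →ₗ[k] S ⧸ J ^ (n + 1) := (Submodule.mkQ (J ^ (n + 1))).restrictScalars k
  have hπ : ∀ y, π y = 0 ↔ y ∈ J ^ (n + 1) := fun y => Submodule.Quotient.mk_eq_zero _
  have hX : ∀ n b, (V ^ n * 𝒜 b).FG := fun n b => (hVfg.pow n).mul (hfg b)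
  let φ : Fin p → S →ₗ[k] S ⧸ J ^ (n + 1) := fun e => π.comp (LinearMap.mulLeft k (a e))
  have h1 := rk_le_rk_inf_add_sum (hX n b) φ Finset.univ
  have h2 : rk (V ^ n * 𝒜 b ⊓ ⨅ e ∈ Finset.univ, LinearMap.ker (φ e)) ≤
      rk (torsionPart k (gPlus 𝒜) J n ⊓ 𝒜 (r * n + b)) := by
    refine rk_mono (fg_of_le (hfg _) inf_le_right) ?_
    rintro y ⟨hy, hy'⟩
    rw [← span_pow_inf_grade hstd hVr] at hy
    refine ⟨⟨hy.1, b₀ + r, mul_mem_of_mem_gPlus_pow hstd fun x hx => ?_⟩, hy.2⟩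
    rw [← ha] at hx
    induction hx using Submodule.span_induction with
    | mem x hx =>
      obtain ⟨e, rfl⟩ := hx
      simp only [Finset.mem_univ, iInf_pos, SetLike.mem_coe, Submodule.mem_iInf] at hy'
      exact (hπ _).1 (hy' e)
    | zero => rw [zero_mul]; exact zero_mem _
    | add x x' _ _ h h' => rw [add_mul]; exact add_mem h h'
    | smul c x _ h => rw [smul_mul_assoc]; exact Submodule.smul_of_tower_mem _ c h
  have h3 : ∀ e, rk ((V ^ n * 𝒜 b).map (φ e)) ≤
      rk (V ^ n * 𝒜 (b + b₀ + r)) - rk (V ^ (n + 1) * 𝒜 (b + b₀)) := by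
    intro e
    have h4 : rk (V ^ (n + 1) * 𝒜 (b + b₀)) ≤
        rk (V ^ n * 𝒜 (b + b₀ + r) ⊓ LinearMap.ker π) := by
      refine rk_mono (fg_of_le (hX n _) inf_le_left) ?_
      rw [← span_pow_inf_grade hstd hVr n, ← span_pow_succ_inf_grade hstd hVr n, add_comm r]
      rintro y ⟨hy, hy'⟩
      exact ⟨⟨Ideal.pow_le_pow_right (Nat.le_succ n) hy, hy'⟩, (hπ y).2 hy⟩
    have h5 : rk ((V ^ n * 𝒜 b).map (φ e)) ≤ rk ((V ^ n * 𝒜 (b + b₀ + r)).map π) := by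
      refine rk_mono ((hX n _).map π) ?_
      rw [Submodule.map_comp]
      refine Submodule.map_mono ?_
      rw [Submodule.map_le_iff_le_comap]
      intro y hy
      have hae : a e ∈ 𝒜 (b₀ + r) := ha ▸ Submodule.subset_span ⟨e, rfl⟩
      rw [show b + b₀ + r = (b₀ + r) + b by ring, ← grade_mul hstd]
      have h6 := Submodule.mul_mem_mul hae hy
      rwa [mul_left_comm] at h6
    have h7 := rk_map_add_rk_inf_ker (hX n (b + b₀ + r)) π
    linarith
  have h8 := Finset.sum_le_sum fun e (_ : e ∈ Finset.univ) => h3 e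
  rw [Finset.sum_const, Finset.card_univ, Fintype.card_fin, nsmul_eq_mul] at h8
  linarith

variable {i b₀ : ℕ} {m : ℕ → ℝ}

lemma tendsto_rk_sub_rk_torsionPart (hfg : ∀ n, (𝒜 n).FG) (hVr : V ≤ 𝒜 r)
    (hm : ∀ b, b₀ ≤ b → Tendsto (fun n : ℕ => (i.factorial : ℝ) / (n : ℝ) ^ i *
      rk (V ^ n * 𝒜 b)) atTop (nhds (m b)))
    (hper : ∀ b, b₀ ≤ b → m (b + r) = m b)
    (hdiff : ∀ b, Tendsto (fun n : ℕ => (i.factorial : ℝ) / (n : ℝ) ^ i *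
      (rk (V ^ (n + 1) * 𝒜 b) - rk (V ^ n * 𝒜 b))) atTop (nhds 0)) (b : ℕ) :
    Tendsto (fun n : ℕ => (i.factorial : ℝ) / (n : ℝ) ^ i * (rk (V ^ n * 𝒜 b) -
        rk (torsionPart k (gPlus 𝒜) (Ideal.span (V : Set S)) n ⊓ 𝒜 (r * n + b))))
      atTop (nhds 0) := by
  obtain ⟨p, hp⟩ := exists_rk_sub_rk_torsionPart_le hstd hfg hVr b b₀
  have hVfg : V.FG := fg_of_le (hfg r) hVr
  have hlim : Tendsto (fun n : ℕ => p * ((i.factorial : ℝ) / (n : ℝ) ^ i *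
      rk (V ^ n * 𝒜 (b + b₀ + r)) - ((i.factorial : ℝ) / (n : ℝ) ^ i *
        (rk (V ^ (n + 1) * 𝒜 (b + b₀)) - rk (V ^ n * 𝒜 (b + b₀))) +
      (i.factorial : ℝ) / (n : ℝ) ^ i * rk (V ^ n * 𝒜 (b + b₀))))) atTop (nhds 0) := by
    have h := ((hm (b + b₀ + r) (by omega)).sub
      ((hdiff (b + b₀)).add (hm (b + b₀) (by omega)))).const_mul (p : ℝ)
    rwa [hper _ (by omega), zero_add, sub_self, mul_zero] at h
  refine squeeze_zero (fun n => mul_nonneg (by positivity) (sub_nonneg.2 ?_)) (fun n => ?_) hlim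
  · refine rk_mono ((hVfg.pow n).mul (hfg b)) ?_
    rw [← span_pow_inf_grade hstd hVr]
    exact inf_le_inf_right _ fun y hy => hy.1
  · refine (mul_le_mul_of_nonneg_left (hp n) (by positivity)).trans_eq ?_
    ring

/-- The `j`-multiplicity is the sum of the limits `m b` over a window of `r` degrees. -/
lemma jMult_eq_sum_window [IsNoetherianRing S] [hprime : (gPlus 𝒜).IsPrime]
    (hfg : ∀ n, (𝒜 n).FG) (hVr : V ≤ 𝒜 r)
    (hm : ∀ b, b₀ ≤ b → Tendsto (fun n : ℕ => (i.factorial : ℝ) / (n : ℝ) ^ i *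
      rk (V ^ n * 𝒜 b)) atTop (nhds (m b)))
    (hper : ∀ b, b₀ ≤ b → m (b + r) = m b)
    (hdiff : ∀ b, Tendsto (fun n : ℕ => (i.factorial : ℝ) / (n : ℝ) ^ i *
      (rk (V ^ (n + 1) * 𝒜 b) - rk (V ^ n * 𝒜 b))) atTop (nhds 0)) :
    jMult (IsLocalRing.maximalIdeal (Localization.AtPrime (gPlus 𝒜)))
        ((Ideal.span (V : Set S)).map (algebraMap S (Localization.AtPrime (gPlus 𝒜))))
        (Localization.AtPrime (gPlus 𝒜)) (i + 1) = ∑ j ∈ Finset.range r, m (b₀ + j) := by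
  obtain ⟨N, -, hN⟩ := exists_toNat_mLength_H0_eq_sum hstd hfg hVr
  set M := max N b₀ with hM
  rw [← sum_window_eq hper (show b₀ ≤ M from le_max_right _ _)]
  refine Tendsto.limUnder_eq ?_
  have h1 := (tendsto_finsetSum (Finset.range r) fun j _ => hm (M + j) (by omega)).sub
    ((tendsto_finsetSum (Finset.range M) fun b _ => hdiff b).add
      (tendsto_finsetSum (Finset.range (r + M)) fun b _ =>
        tendsto_rk_sub_rk_torsionPart hstd hfg hVr hm hper hdiff b))
  rw [Finset.sum_const_zero, Finset.sum_const_zero, add_zero, sub_zero] at h1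
  refine h1.congr fun n => ?_
  rw [hN (r + M) (by omega), add_tsub_cancel_right, ← Finset.mul_sum, ← Finset.mul_sum,
    ← Finset.mul_sum, ← mul_add, ← mul_sub]
  congr 1
  rw [Finset.sum_sub_distrib, Finset.sum_sub_distrib, Finset.sum_sub_distrib,
    Finset.sum_range_add (fun b => rk ((Ideal.span (V : Set S) ^ (n + 1)).restrictScalars k ⊓
      𝒜 (r * n + b))), add_comm r M, Finset.sum_range_add (fun b => rk (V ^ n * 𝒜 b)),
    Finset.sum_eq_zero (s := Finset.range r) (f := fun b =>
      rk ((Ideal.span (V : Set S) ^ (n + 1)).restrictScalars k ⊓ 𝒜 (r * n + b)))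
      fun b hb => by
        rw [span_pow_succ_inf_grade_of_lt hstd hVr n (Finset.mem_range.1 hb), rk_bot]]
  simp_rw [span_pow_succ_inf_grade hstd hVr]
  ring

end JMultiplicityLimit

section GeneralFormula

variable {k S : Type*} [Field k] [CommRing S] [Algebra k S]
  {𝒜 : ℕ → Submodule k S} [GradedAlgebra 𝒜]

lemma linComb_mem {V : Submodule k S} {i m : ℕ} {x : Fin m → S} (hx : ∀ l, x l ∈ V)
    (c : Fin i × Fin m → k) (j : Fin i) : linComb x c j ∈ V :=
  sum_mem fun l _ => V.smul_mem _ (hx l)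

/-- If the formula for the `j`-multiplicity can be established for one choice of coefficients,
then it holds for general ones. -/
lemma exists_polynomial_jMult_eq [IsNoetherianRing S] [hprime : (gPlus 𝒜).IsPrime]
    (hstd : ∀ n : ℕ, 𝒜 n = 𝒜 1 ^ n) {V : Submodule k S} {r i m a : ℕ} (hVr : V ≤ 𝒜 r)
    (hr : 0 < r) (hfg : ∀ n, (𝒜 n).FG) {x : Fin m → S} (hx : ∀ l, x l ∈ V)
    (c₀ : Fin i × Fin m → k) {h : S} (hh : h ∈ V)
    (hC : SurjAt 𝒜 V (Submodule.span k (Set.range (linComb x c₀))) h r a)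
    (hreg : FilterRegSeq 𝒜 V i (linComb x c₀)) {g : Fin 2 → S} (hg : ∀ j, g j ∈ V)
    (hgreg : FilterRegSeq 𝒜 V 2 g) :
    ∃ F : MvPolynomial (Fin i × Fin m) k, F ≠ 0 ∧ ∀ c, MvPolynomial.eval c F ≠ 0 →
      jMult (IsLocalRing.maximalIdeal (Localization.AtPrime (gPlus 𝒜)))
        ((Ideal.span (V : Set S)).map (algebraMap S (Localization.AtPrime (gPlus 𝒜))))
        (Localization.AtPrime (gPlus 𝒜)) (i + 1) =
      r * hsMult (gPlus 𝒜) (S ⧸ (Ideal.span (Set.range (linComb x c))).colon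
        (Ideal.span (V : Set S) : Set S)) 1 := by
  have hV : V.FG := fg_of_le (hfg r) hVr
  obtain ⟨b₀, hab, hper, hlim⟩ :=
    hC.exists_tendsto hstd hfg hVr hV hh (linComb_mem hx c₀) hreg
  set q : ℕ → ℝ := fun b => defect V (Submodule.span k (Set.range (linComb x c₀))) (𝒜 b) 1
  have hZ : (Submodule.span k {h} * (V * 𝒜 a)).FG :=
    (Submodule.fg_span_singleton h).mul (hV.mul (hfg a))
  obtain ⟨F₁, hF₁, hF₁'⟩ := exists_polynomial_rk_le x (hfg (a + r)) hZ c₀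
  choose F₂ hF₂ hF₂' using fun b => exists_polynomial_rk_le x (hfg b) Submodule.fg_bot c₀
  refine ⟨F₁ * ∏ j ∈ Finset.range r, F₂ (b₀ + j), fun h0 => ?_, fun c hc => ?_⟩
  · have h1 := congrArg (MvPolynomial.eval c₀) h0
    rw [map_mul, map_prod, map_zero] at h1
    exact mul_ne_zero hF₁ (Finset.prod_ne_zero_iff.2 fun j _ => hF₂ _) h1
  rw [map_mul, map_prod] at hc
  set L := Submodule.span k (Set.range (linComb x c)) with hL
  have hLV : L ≤ V := span_range_le (linComb_mem hx c)
  have hC' : SurjAt 𝒜 V L h r a := by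
    refine (eq_of_le_of_rk_le (hV.mul (hfg _)) (sup_le (mul_le_mul' hLV le_rfl)
      (span_mul_le hstd hVr hh a)) ?_).ge
    refine le_trans ?_ (hF₁' c (left_ne_zero_of_mul hc))
    exact rk_mono (((span_range_fg _).mul (hfg _)).sup hZ) hC
  have hle : ∀ b, b₀ ≤ b → defect V L (𝒜 b) 1 ≤ q b := by
    intro b
    induction b using Nat.strong_induction_on with
    | _ b ih =>
      intro hb
      by_cases hbr : b < b₀ + r
      · have h1 := hF₂' b c (by
          have h2 := Finset.prod_ne_zero_iff.1 (right_ne_zero_of_mul hc) (b - b₀)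
            (Finset.mem_range.2 (by omega))
          rwa [Nat.add_sub_cancel' hb] at h2)
        simp only [sup_bot_eq] at h1
        simp only [q, defect, pow_one, Nat.sub_self, pow_zero, one_mul]
        exact sub_le_sub_left h1 _
      · obtain ⟨b', rfl⟩ := Nat.exists_eq_add_of_le' (le_trans le_add_self (not_lt.1 hbr))
        exact (hC'.defect_add_le hstd hfg hVr hV hLV hh (by omega)).trans
          ((ih b' (by omega) (by omega)).trans_eq (hper b' (by omega)).symm)
  have heq : ∀ b, b₀ ≤ b → defect V L (𝒜 b) 1 = q b := fun b hb =>
    (hle b hb).antisymm ((hC'.growthLE_rk hstd hfg hVr hV hh (linComb_mem hx c)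
      (hab.trans hb)).le_of_tendsto (hlim b hb))
  have hst : ∀ b, b₀ ≤ b → defect V L (𝒜 (b + r)) 1 = defect V L (𝒜 b) 1 := fun b hb => by
    rw [heq b hb, heq _ (by omega)]; exact hper b hb
  rw [jMult_eq_sum_window hstd hfg hVr hlim hper
    (tendsto_rk_diff hstd hfg hVr hV hr hlim hg hgreg), ← ideal_span_submodule_span (k := k),
    ← hL, hsMult_eq_average hstd hfg
      (proj_mem_colon_span hVr (hLV.trans hVr)) hr (b₀ := b₀) (q := q) (fun b hb => ?_) hper]
  · field_simp
    rfl
  · rw [← heq b hb]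
    exact hC'.rk_colon hstd hfg hVr hV hLV hh hab hst hb

end GeneralFormula

section Generic

variable {k S : Type*} [Field k] [CommRing S] [Algebra k S]

/-- The property `p` holds for all elements of `V` outside finitely many proper subspaces. -/
def IsGeneric (V : Submodule k S) (p : S → Prop) : Prop :=
  ∃ s : Set (Submodule k S), s.Finite ∧ (∀ W ∈ s, ¬ V ≤ W) ∧ ∀ v ∈ V, (∀ W ∈ s, v ∉ W) → p v

variable {V : Submodule k S}

lemma IsGeneric.mono {p q : S → Prop} (h : IsGeneric V p) (hpq : ∀ v ∈ V, p v → q v) :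
    IsGeneric V q := by
  obtain ⟨s, hs, hV, hp⟩ := h
  exact ⟨s, hs, hV, fun v hv hvs => hpq v hv (hp v hv hvs)⟩

lemma IsGeneric.and {p q : S → Prop} (hp : IsGeneric V p) (hq : IsGeneric V q) :
    IsGeneric V fun v => p v ∧ q v := by
  obtain ⟨s, hs, hVs, hp⟩ := hp
  obtain ⟨t, ht, hVt, hq⟩ := hq
  exact ⟨s ∪ t, hs.union ht, fun W hW => hW.elim (hVs W) (hVt W), fun v hv h =>
    ⟨hp v hv fun W hW => h W (Or.inl hW), hq v hv fun W hW => h W (Or.inr hW)⟩⟩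

lemma isGeneric_forall_notMem {ι : Type*} {t : Set ι} (ht : t.Finite) {W : ι → Submodule k S}
    (hW : ∀ P ∈ t, ¬ V ≤ W P) : IsGeneric V fun v => ∀ P ∈ t, v ∉ W P :=
  ⟨W '' t, ht.image W, fun _ ⟨P, hP, h⟩ => h ▸ hW P hP,
    fun _ _ h P hP => h _ ⟨P, hP, rfl⟩⟩

lemma IsGeneric.exists [Infinite k] {p : S → Prop} (h : IsGeneric V p) : ∃ v ∈ V, p v := by
  classical
  obtain ⟨s, hs, hVs, hp⟩ := h
  have h1 := Subspace.biUnion_ne_univ_of_top_notMem (k := k) (E := V)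
    (s := hs.toFinset.image fun W => W.comap V.subtype) (by
      simp only [Finset.mem_image, Set.Finite.mem_toFinset, not_exists, not_and]
      intro W hW h0
      exact hVs W hW fun v hv => by
        have : (⟨v, hv⟩ : V) ∈ W.comap V.subtype := h0 ▸ Submodule.mem_top
        exact this)
  obtain ⟨v, hv⟩ := (Set.ne_univ_iff_exists_notMem _).1 h1
  refine ⟨v, v.2, hp v v.2 fun W hW hvW => hv ?_⟩
  simp only [Set.mem_iUnion]
  exact ⟨_, Finset.mem_image_of_mem _ (hs.mem_toFinset.2 hW), hvW⟩

end Generic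

section FilterRegularGeneric

variable {k : Type*} [Field k]

/-- General elements are nonzerodivisors on large powers, modulo any ideal. -/
lemma isGeneric_mem_of_mul_mem {S B : Type*} [CommRing S] [Algebra k S] [CommRing B]
    [IsNoetherianRing B] [Algebra k B] {V : Submodule k S} (ι : V →ₗ[k] B) (K : Ideal B) :
    IsGeneric V fun g => ∃ N, ∀ z ∈ Ideal.span (Set.range ι) ^ N,
      (∀ hg : g ∈ V, ι ⟨g, hg⟩ * z ∈ K) → z ∈ K := by
  set I := Ideal.span (Set.range ι) with hI
  obtain ⟨N, hN⟩ := exists_uniform_torsion_quotient I K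
  let Ks : Ideal B :=
    { carrier := {z | ∀ x ∈ I ^ N, x * z ∈ K}
      add_mem' := fun ha hb x hx => by rw [mul_add]; exact add_mem (ha x hx) (hb x hx)
      zero_mem' := fun x _ => by rw [mul_zero]; exact zero_mem _
      smul_mem' := fun c a ha x hx => by
        rw [smul_eq_mul, mul_left_comm]; exact Ideal.mul_mem_left _ _ (ha x hx) }
  have hKs : ∀ z, (∀ v, ι v * z ∈ Ks) → z ∈ Ks := by
    intro z hz
    refine (hN z ⟨N + 1, fun x hx => ?_⟩).1
    rw [pow_succ] at hx
    refine Submodule.mul_induction_on hx (fun a ha b hb => ?_) fun a b ha hb => by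
      rw [add_mul]; exact add_mem ha hb
    have h1 : ∀ b ∈ I, b * z ∈ Ks := by
      intro b hb
      induction hb using Submodule.span_induction with
      | mem x hx => obtain ⟨v, rfl⟩ := hx; exact hz v
      | zero => rw [zero_mul]; exact zero_mem _
      | add x x' _ _ h h' => rw [add_mul]; exact add_mem h h'
      | smul a x _ h => rw [smul_eq_mul, mul_assoc]; exact Ideal.mul_mem_left _ _ h
    rw [mul_assoc]
    exact h1 b hb a ha
  have hmk : ∀ b z : B, b • Ks.mkQ z = 0 ↔ b * z ∈ Ks := fun b z => by
    rw [← map_smul, smul_eq_mul]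
    exact Submodule.Quotient.mk_eq_zero Ks
  refine (isGeneric_forall_notMem (associatedPrimes.finite B (B ⧸ Ks))
    (W := fun P => ((P.restrictScalars k).comap ι).map V.subtype) fun P hP hVP => ?_).mono
    fun g hg hgP => ⟨N, fun z hz hgz => (hN z ?_).2 hz⟩
  · obtain ⟨hP1, w, hw⟩ := isAssociatedPrime_iff.1 hP
    obtain ⟨z, rfl⟩ := Ks.mkQ_surjective w
    have hz : ∀ b, b ∈ P ↔ b * z ∈ Ks := fun b => by
      rw [hw, Submodule.mem_colon_singleton, Submodule.mem_bot, hmk]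
    refine hP1.ne_top ((Ideal.eq_top_iff_one P).2 ((hz 1).2 ?_))
    rw [one_mul]
    refine hKs z fun v => (hz _).1 ?_
    obtain ⟨v', hv', hvv⟩ := hVP v.2
    rw [← Subtype.ext hvv]
    exact hv'
  · refine ⟨N, ?_⟩
    change z ∈ Ks
    by_contra hzK
    have h1 : ι ⟨g, hg⟩ ∈ ⋃ P ∈ associatedPrimes B (B ⧸ Ks), (P : Set B) := by
      rw [biUnion_associatedPrimes_eq_zero_divisors]
      refine ⟨Ks.mkQ z, fun h0 => hzK ((Submodule.Quotient.mk_eq_zero Ks).1 h0),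
        (hmk _ _).2 fun x _ => Ideal.mul_mem_left _ _ (hgz hg)⟩
    simp only [Set.mem_iUnion] at h1
    obtain ⟨P, hP, hgP'⟩ := h1
    exact hgP P hP ⟨⟨g, hg⟩, hgP', rfl⟩

variable {S : Type*} [CommRing S] [IsNoetherianRing S] [Algebra k S]
  {𝒜 : ℕ → Submodule k S} [GradedAlgebra 𝒜]

/-- General elements are filter-regular. -/
lemma isGeneric_filterReg (hstd : ∀ n : ℕ, 𝒜 n = 𝒜 1 ^ n) {V L : Submodule k S} {r : ℕ}
    (hVr : V ≤ 𝒜 r) (hLV : L ≤ V) : IsGeneric V (FilterReg 𝒜 V L) := by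
  set J := Ideal.span (V : Set S) with hJ
  have hVJ : ∀ n, ∀ v ∈ V ^ n, v ∈ J ^ n := fun n v hv => by
    rw [hJ, ← ideal_span_pow]; exact Ideal.subset_span hv
  have hVJ1 : ∀ v ∈ V, v ∈ J ^ 1 := fun v hv => hVJ 1 v (by rwa [pow_one])
  let ι : V →ₗ[k] reesAlgebra J :=
    ((reesMonomial J 1).restrictScalars k).comp
      (LinearMap.codRestrict ((J ^ 1).restrictScalars k) V.subtype fun v =>
        (Submodule.restrictScalars_mem k (J ^ 1) _).2 (hVJ1 v.1 v.2))
  let Λ : ℕ → Ideal S := fun n => n.casesOn ⊥ fun n => Ideal.span (L : Set S) * J ^ n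
  have hΛ : ∀ i j, J ^ i * Λ j ≤ Λ (i + j) := by
    rintro i (_ | j)
    · simp [Λ]
    · rw [← add_assoc]
      refine le_of_eq ?_
      change J ^ i * (Ideal.span (L : Set S) * J ^ j) = Ideal.span (L : Set S) * J ^ (i + j)
      rw [mul_left_comm, pow_add]
  let K : Ideal (reesAlgebra J) :=
    { carrier := {z | ∀ n, (z : Polynomial S).coeff n ∈ Λ n}
      add_mem' := fun ha hb n => by simpa using add_mem (ha n) (hb n)
      zero_mem' := fun n => by simp
      smul_mem' := fun a z hz n => by
        rw [smul_eq_mul, Subalgebra.coe_mul, Polynomial.coeff_mul]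
        refine sum_mem fun p hp => ?_
        rw [← Finset.HasAntidiagonal.mem_antidiagonal.1 hp]
        exact hΛ _ _ (Ideal.mul_mem_mul ((mem_reesAlgebra_iff J _).1 a.2 _) (hz _)) }
  have hK : ∀ n (y : ↥(J ^ n)), reesMonomial J n y ∈ K ↔ (y : S) ∈ Λ n := by
    intro n y
    refine ⟨fun h => by simpa [reesMonomial] using h n, fun h m => ?_⟩
    by_cases hm : n = m
    · subst hm; simpa [reesMonomial] using h
    · simp [reesMonomial, Polynomial.coeff_monomial, hm]
  have hmul : ∀ (v : V) (n : ℕ) (y : S) (hy : y ∈ J ^ n) (h : (v : S) * y ∈ J ^ (n + 1)),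
      ι v * reesMonomial J n ⟨y, hy⟩ = reesMonomial J (n + 1) ⟨v * y, h⟩ := by
    intro v n y hy h
    refine Subtype.ext ?_
    change Polynomial.monomial 1 (v : S) * Polynomial.monomial n y = _
    rw [Polynomial.monomial_mul_monomial, add_comm 1 n]
    rfl
  let W : ℕ → Submodule S S := fun n => (((Ideal.span (Set.range ι) ^ n).restrictScalars S).comap
    (reesMonomial J n)).map (J ^ n).subtype
  have hW : ∀ n, J ^ n ≤ W n := by
    intro n
    induction n with
    | zero => exact fun y hy => ⟨⟨y, hy⟩, by simp, rfl⟩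
    | succ n ih =>
      rw [pow_succ']
      refine Submodule.mul_le.2 fun a ha b hb => ?_
      induction ha using Submodule.span_induction with
      | mem a ha =>
        obtain ⟨⟨b, hb'⟩, hb'', rfl⟩ := ih hb
        have h : a * b ∈ J ^ (n + 1) := by
          rw [pow_succ']; exact Ideal.mul_mem_mul (Ideal.subset_span ha) hb'
        refine ⟨⟨_, h⟩, ?_, rfl⟩
        rw [SetLike.mem_coe, Submodule.mem_comap, ← hmul ⟨a, ha⟩ n b hb' h, pow_succ']
        exact Ideal.mul_mem_mul (Ideal.subset_span ⟨_, rfl⟩) hb''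
      | zero => rw [zero_mul]; exact zero_mem _
      | add a a' _ _ h h' => rw [add_mul]; exact add_mem h h'
      | smul c a _ h => rw [smul_mul_assoc]; exact Submodule.smul_mem _ _ h
  refine (isGeneric_mem_of_mul_mem ι K).mono fun g hg ⟨N, hN⟩ => ⟨N + 1, fun n hn b x hx hgx => ?_⟩
  obtain ⟨n, rfl⟩ := Nat.exists_eq_add_of_le' (le_trans le_add_self hn)
  have hxJ : ∀ y ∈ V ^ (n + 1) * 𝒜 b, y ∈ J ^ (n + 1) := fun y hy => by
    rw [hJ, ← ideal_span_pow]; exact mem_ideal_span_of_mem_mul hy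
  obtain ⟨⟨x, hx'⟩, hxI, rfl⟩ := hW _ (hxJ x hx)
  have h1 : g * x ∈ Ideal.span (L : Set S) * J ^ (n + 1) := by
    refine Submodule.mul_induction_on hgx (fun a ha y hy => ?_) fun a b ha hb => add_mem ha hb
    exact Ideal.mul_mem_mul (Ideal.subset_span ha) (hxJ y hy)
  have h2 := (hK _ _).1 (hN _ (Ideal.pow_le_pow_right (show N ≤ n + 1 by omega) hxI) fun hg' => by
    rw [hmul ⟨g, hg'⟩ (n + 1) x hx' (by
      rw [pow_succ']; exact Ideal.mul_mem_mul (by simpa using hVJ1 g hg) hx'), hK]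
    exact h1)
  change x ∈ Ideal.span (L : Set S) * J ^ n at h2
  rw [hJ, ← ideal_span_pow, ← ideal_span_mul] at h2
  rw [Nat.add_sub_cancel, ← mul_assoc]
  refine mem_mul_of_mem_span (s := r * (n + 1)) ?_ h2
    (pow_mul_le_grade hstd hVr _ b hx)
  refine (mul_le_mul' hLV (le_refl (V ^ n))).trans ?_
  rw [← pow_succ']
  exact pow_le_grade hstd hVr (n + 1)

end FilterRegularGeneric

section BasicElements

/-- Up to a multiplier outside `P`, the ideal `J` is generated modulo `I` by at most `s` elements
of `W`. -/
def GenBy {S : Type*} [CommRing S] (W : Set S) (J I P : Ideal S) (s : ℕ) : Prop :=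
  ∃ T : Finset S, (T : Set S) ⊆ W ∧ T.card ≤ s ∧
    ∃ t, t ∉ P ∧ ∀ y ∈ J, t * y ∈ Ideal.span (T : Set S) ⊔ I

variable {S : Type*} [CommRing S] {W : Set S} {J I I' P : Ideal S} {s s' : ℕ}

lemma GenBy.mono (h : GenBy W J I P s) (hI : I ≤ I') (hs : s ≤ s') : GenBy W J I' P s' := by
  obtain ⟨T, hT, hc, t, ht, h⟩ := h
  exact ⟨T, hT, hc.trans hs, t, ht, fun y hy => sup_le_sup_left hI _ (h y hy)⟩

lemma genBy_zero_iff : GenBy W J I P 0 ↔ ∃ t, t ∉ P ∧ ∀ y ∈ J, t * y ∈ I := by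
  constructor
  · rintro ⟨T, -, hc, h⟩
    rw [Nat.le_zero, Finset.card_eq_zero] at hc
    subst hc
    simpa using h
  · rintro h
    exact ⟨∅, by simp, by simp, by simpa using h⟩

/-- A multiplier for each generator yields a common multiplier. -/
lemma exists_mul_mem_of_forall [P.IsPrime] {K : Ideal S} {X : Set S} (hJ : J.FG)
    (hX : Ideal.span X = J) (h : ∀ y ∈ X, ∃ t, t ∉ P ∧ t * y ∈ K) :
    ∃ t, t ∉ P ∧ ∀ y ∈ J, t * y ∈ K := by
  classical
  have h1 : ∀ y ∈ J, ∃ t, t ∉ P ∧ t * y ∈ K := by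
    intro y hy
    rw [← hX] at hy
    induction hy using Submodule.span_induction with
    | mem x hx => exact h x hx
    | zero => exact ⟨1, Ideal.one_notMem P, by simp⟩
    | add x y _ _ hx hy =>
      obtain ⟨t, ht, hx⟩ := hx
      obtain ⟨u, hu, hy⟩ := hy
      refine ⟨t * u, fun h => (‹P.IsPrime›.mem_or_mem h).elim ht hu, ?_⟩
      rw [mul_add]
      refine add_mem ?_ ?_
      · rw [mul_comm t, mul_assoc]; exact K.mul_mem_left _ hx
      · rw [mul_assoc]; exact K.mul_mem_left _ hy
    | smul a x _ hx =>
      obtain ⟨t, ht, hx⟩ := hx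
      refine ⟨t, ht, ?_⟩
      rw [smul_eq_mul, mul_left_comm]
      exact K.mul_mem_left _ hx
  obtain ⟨Y, rfl⟩ := hJ
  choose! t ht htK using h1
  have hY : ∀ y ∈ Y, y ∈ Ideal.span (Y : Set S) := fun y hy => Ideal.subset_span hy
  refine ⟨∏ y ∈ Y, t y, fun hP => ?_, fun y hy => ?_⟩
  · obtain ⟨y, hy, hyP⟩ := (Ideal.IsPrime.prod_mem_iff).1 hP
    exact ht y (hY y hy) hyP
  · induction hy using Submodule.span_induction with
    | mem y hy =>
      rw [← Finset.prod_erase_mul _ _ hy, mul_assoc]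
      exact K.mul_mem_left _ (htK y (hY y hy))
    | zero => simp
    | add x y _ _ hx hy => rw [mul_add]; exact add_mem hx hy
    | smul a x _ hx => rw [smul_eq_mul, mul_left_comm]; exact K.mul_mem_left _ hx

/-- Nakayama's lemma, up to a multiplier outside `P`. -/
lemma exists_mul_mem_of_nakayama [P.IsPrime] (hJ : J.FG)
    (h : ∃ t, t ∉ P ∧ ∀ y ∈ J, t * y ∈ P * J ⊔ I) : ∃ t, t ∉ P ∧ ∀ y ∈ J, t * y ∈ I := by
  obtain ⟨t, ht, h⟩ := h
  refine exists_mul_mem_of_forall (X := J) hJ (Ideal.span_eq J) fun y hy => ?_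
  have key : J.map (algebraMap S (Localization.AtPrime P)) ≤
      I.map (algebraMap S (Localization.AtPrime P)) := by
    refine Submodule.le_of_le_smul_of_le_jacobson_bot
      (I := P.map (algebraMap S (Localization.AtPrime P))) (hJ.map _) ?_ ?_
    · rw [IsLocalRing.jacobson_eq_maximalIdeal _ bot_ne_top,
        Localization.AtPrime.map_eq_maximalIdeal]
    · rw [smul_eq_mul, ← Ideal.map_mul, ← Submodule.add_eq_sup, add_comm, Submodule.add_eq_sup,
        ← Ideal.map_sup, Ideal.map_le_iff_le_comap]
      intro y hy
      rw [Ideal.mem_comap,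
        IsLocalization.algebraMap_mem_map_algebraMap_iff P.primeCompl]
      exact ⟨t, ht, h y hy⟩
  have h1 := key (Ideal.mem_map_of_mem _ hy)
  rw [IsLocalization.algebraMap_mem_map_algebraMap_iff P.primeCompl] at h1
  exact h1

/-- Exchange: a basic element replaces one of the generators. -/
lemma GenBy.exchange [P.IsPrime] (hW : W ⊆ J) (h : GenBy W J I P (s + 1)) {f : S} (hf : f ∈ J)
    (hfP : ¬ ∃ t, t ∉ P ∧ t * f ∈ P * J ⊔ I) : GenBy W J (I ⊔ Ideal.span {f}) P s := by
  classical
  obtain ⟨T, hT, hc, t, ht, h⟩ := h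
  obtain ⟨u, hu, z, hz, huz⟩ := Submodule.mem_sup.1 (h f hf)
  obtain ⟨a, -, ha⟩ := Submodule.mem_span_finset.1 hu
  obtain ⟨v, hv, hva⟩ : ∃ v ∈ T, a v ∉ P := by
    by_contra! hall
    refine hfP ⟨t, ht, ?_⟩
    rw [← huz, ← ha]
    exact add_mem (Submodule.mem_sup_left (Submodule.sum_mem _ fun v hv =>
      Ideal.mul_mem_mul (hall v hv) (hW (hT hv)))) (Submodule.mem_sup_right hz)
  set K := Ideal.span ((T.erase v : Finset S) : Set S) ⊔ (I ⊔ Ideal.span {f}) with hK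
  have hTK : ∀ w ∈ T.erase v, w ∈ K := fun w hw => Submodule.mem_sup_left (Ideal.subset_span hw)
  have hIK : I ≤ K := le_sup_left.trans le_sup_right
  have hfK : f ∈ K := Submodule.mem_sup_right (Submodule.mem_sup_right
    (Ideal.subset_span rfl))
  have hvK : a v * v ∈ K := by
    have h1 : a v * v = t * f - z - ∑ w ∈ T.erase v, a w • w := by
      rw [← huz, ← ha, ← Finset.add_sum_erase _ _ hv, smul_eq_mul]
      ring
    rw [h1]
    exact sub_mem (sub_mem (K.mul_mem_left _ hfK) (hIK hz))
      (Submodule.sum_mem _ fun w hw => K.mul_mem_left _ (hTK w hw))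
  have hle : Ideal.span (T : Set S) ⊔ I ≤ Submodule.comap (LinearMap.mulLeft S (a v)) K := by
    refine sup_le (Ideal.span_le.2 fun w hw => ?_) fun w hw => K.mul_mem_left _ (hIK hw)
    by_cases hwv : w = v
    · subst hwv; exact hvK
    · exact K.mul_mem_left _ (hTK w (Finset.mem_erase.2 ⟨hwv, hw⟩))
  refine ⟨T.erase v, fun w hw => hT (Finset.mem_of_mem_erase hw), ?_, a v * t,
    fun h => (‹P.IsPrime›.mem_or_mem h).elim hva ht, fun y hy => ?_⟩
  · rw [Finset.card_erase_of_mem hv]; omega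
  · rw [mul_assoc]
    exact hle (h y hy)

/-- Generators may be chosen in any given generating set. -/
lemma GenBy.of_span [P.IsPrime] (hJ : J.FG) (hW : Ideal.span W = J)
    (h : GenBy (J : Set S) J I P s) : GenBy W J I P s := by
  classical
  induction s generalizing I with
  | zero => rw [genBy_zero_iff] at h ⊢; exact h
  | succ s ih =>
    by_cases hall : ∀ f ∈ W, ∃ t, t ∉ P ∧ t * f ∈ P * J ⊔ I
    · exact (genBy_zero_iff.2 (exists_mul_mem_of_nakayama hJ
        (exists_mul_mem_of_forall hJ hW hall))).mono le_rfl (Nat.zero_le _)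
    · simp only [not_forall] at hall
      obtain ⟨f, hfW, hf⟩ := hall
      have hfJ : f ∈ J := hW ▸ Ideal.subset_span hfW
      obtain ⟨T, hT, hc, t, ht, h⟩ := ih (h.exchange subset_rfl hfJ hf)
      refine ⟨insert f T, ?_, (Finset.card_insert_le _ _).trans (by omega), t, ht, fun y hy => ?_⟩
      · rw [Finset.coe_insert]; exact Set.insert_subset hfW hT
      · rw [Finset.coe_insert, Ideal.span_insert, sup_comm (Ideal.span {f}), sup_assoc,
          sup_comm (Ideal.span {f})]
        exact h y hy

lemma genBy_of_mu_le [P.IsPrime] (hJ : J.FG)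
    (h : mu (J.map (algebraMap S (Localization.AtPrime P))) ≤ s) :
    GenBy (J : Set S) J ⊥ P s := by
  classical
  set A := Localization.AtPrime P
  have hne : ((fun s : Finset A => (s.card : ℕ∞)) ''
      {s | Ideal.span (s : Set A) = J.map (algebraMap S A)}).Nonempty := by
    obtain ⟨Y, hY⟩ := hJ.map (algebraMap S A)
    exact ⟨_, Y, hY, rfl⟩
  obtain ⟨Y, hY, hYc⟩ := csInf_mem hne
  replace hY : Ideal.span (Y : Set A) = J.map (algebraMap S A) := hY
  have hcard : Y.card ≤ s := by
    have : (Y.card : ℕ∞) ≤ s := hYc.le.trans h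
    exact_mod_cast this
  have h1 : ∀ y ∈ Y, ∃ x : J × P.primeCompl, y * algebraMap S A x.2 = algebraMap S A x.1 :=
    fun y hy => (IsLocalization.mem_map_algebraMap_iff P.primeCompl A).1
      (hY ▸ Ideal.subset_span hy)
  choose! x hx using h1
  refine ⟨Y.image fun y => ((x y).1 : S), ?_, Finset.card_image_le.trans hcard, ?_⟩
  · intro z hz
    rw [Finset.mem_coe, Finset.mem_image] at hz
    obtain ⟨y, -, rfl⟩ := hz
    exact (x y).1.2
  refine exists_mul_mem_of_forall (X := J) hJ (Ideal.span_eq J) fun y hy => ?_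
  rw [sup_bot_eq]
  have h2 : J.map (algebraMap S A) ≤ (Ideal.span
      ((Y.image fun y => ((x y).1 : S) : Finset S) : Set S)).map (algebraMap S A) := by
    rw [← hY, Ideal.span_le]
    intro y hy
    have h3 : algebraMap S A (x y).1 ∈ (Ideal.span
      ((Y.image fun y => ((x y).1 : S) : Finset S) : Set S)).map (algebraMap S A) :=
      Ideal.mem_map_of_mem _ (Ideal.subset_span (Finset.mem_image_of_mem _ hy))
    rw [← hx y hy] at h3
    exact (Ideal.mul_unit_mem_iff_mem _ (IsLocalization.map_units A (x y).2)).1 h3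
  have h4 := h2 (Ideal.mem_map_of_mem _ hy)
  rw [IsLocalization.algebraMap_mem_map_algebraMap_iff P.primeCompl] at h4
  exact h4

/-- The ideal defining the locus where `J` needs more than `s` generators modulo `I`. -/
def genIdeal (W : Set S) (J I : Ideal S) (s : ℕ) : Ideal S :=
  Ideal.span {t | ∃ T : Finset S, (T : Set S) ⊆ W ∧ T.card ≤ s ∧
    ∀ y ∈ J, t * y ∈ Ideal.span (T : Set S) ⊔ I}

lemma genBy_iff : GenBy W J I P s ↔ ¬ genIdeal W J I s ≤ P := by
  rw [genIdeal, Ideal.span_le, Set.not_subset]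
  exact ⟨fun ⟨T, hT, hc, t, ht, h⟩ => ⟨t, ⟨T, hT, hc, h⟩, ht⟩,
    fun ⟨t, ⟨T, hT, hc, h⟩, ht⟩ => ⟨T, hT, hc, t, ht, h⟩⟩

end BasicElements

section BasicSequences

/-- At all primes of height `s < d`, the ideal `J` is generated modulo `I` by `s + ε - i`
elements of `V`. -/
def GenUpTo {S : Type*} [CommRing S] (W : Set S) (J I : Ideal S) (d ε i : ℕ) : Prop :=
  ∀ P : PrimeSpectrum S, ∀ s : ℕ, Order.height P = s → s < d →
    GenBy W J I P.asIdeal (s + ε - i)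

variable {k S : Type*} [Field k] [CommRing S] [IsNoetherianRing S] [Algebra k S]
  {V : Submodule k S} {J : Ideal S} {d ε : ℕ}

lemma genUpTo_bot (hV : Ideal.span (V : Set S) = J) (hG : SatisfiesG J d) :
    GenUpTo (V : Set S) J ⊥ d 1 0 := by
  intro P s hs hsd
  by_cases hJP : J ≤ P.asIdeal
  · refine GenBy.mono (s := s) ?_ le_rfl (by omega)
    refine GenBy.of_span (IsNoetherian.noetherian J) hV
      (genBy_of_mu_le (IsNoetherian.noetherian J) ?_)
    rw [← hs]
    exact hG P hJP (by rw [hs]; exact_mod_cast hsd)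
  · rw [← hV, Ideal.span_le, Set.not_subset] at hJP
    obtain ⟨v, hv, hvP⟩ := hJP
    exact ⟨{v}, by simpa using hv, by simp, v, hvP, fun y hy => Submodule.mem_sup_left
      (Ideal.mul_mem_right _ _ (Ideal.subset_span (by simp)))⟩

lemma genUpTo_sq (hV : Ideal.span (V : Set S) = J) (hG : SatisfiesG J d) :
    GenUpTo (V : Set S) J (J * J) d 0 0 := by
  intro P s hs hsd
  by_cases hJP : J ≤ P.asIdeal
  · refine GenBy.mono (s := s) (I := ⊥) ?_ bot_le (by omega)
    refine GenBy.of_span (IsNoetherian.noetherian J) hV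
      (genBy_of_mu_le (IsNoetherian.noetherian J) ?_)
    rw [← hs]
    exact hG P hJP (by rw [hs]; exact_mod_cast hsd)
  · obtain ⟨v, hv, hvP⟩ := SetLike.not_le_iff_exists.1 hJP
    exact (genBy_zero_iff.2 ⟨v, hvP, fun y hy => Ideal.mul_mem_mul hv hy⟩).mono le_rfl
      (Nat.zero_le _)

/-- General elements of `V` are basic at all primes in question. -/
lemma GenUpTo.isGeneric {I : Ideal S} {i : ℕ} (hV : Ideal.span (V : Set S) = J)
    (h : GenUpTo (V : Set S) J I d ε i) :
    IsGeneric V fun f => GenUpTo (V : Set S) J (I ⊔ Ideal.span {f}) d ε (i + 1) := by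
  have hJ : J.FG := IsNoetherian.noetherian J
  have hVJ : (V : Set S) ⊆ J := fun v hv => hV ▸ Ideal.subset_span hv
  have hVJ' : ∀ v ∈ V, v ∈ J := fun v hv => hVJ hv
  let B : Ideal S → Ideal S := fun Q =>
    { carrier := {f | ¬ Q.IsPrime ∨ ∃ t, t ∉ Q ∧ t * f ∈ Q * J ⊔ I}
      add_mem' := by
        rintro x y (hx | ⟨t, ht, hx⟩) hy
        · exact Or.inl hx
        obtain hy | ⟨u, hu, hy⟩ := hy
        · exact Or.inl hy
        by_cases hQ : Q.IsPrime
        · refine Or.inr ⟨t * u, fun h => (hQ.mem_or_mem h).elim ht hu, ?_⟩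
          rw [mul_add]
          refine add_mem ?_ ?_
          · rw [mul_comm t, mul_assoc]; exact Ideal.mul_mem_left _ _ hx
          · rw [mul_assoc]; exact Ideal.mul_mem_left _ _ hy
        · exact Or.inl hQ
      zero_mem' := by
        by_cases hQ : Q.IsPrime
        · exact Or.inr ⟨1, Ideal.one_notMem Q, by simp⟩
        · exact Or.inl hQ
      smul_mem' := by
        rintro a x (hx | ⟨t, ht, hx⟩)
        · exact Or.inl hx
        · refine Or.inr ⟨t, ht, ?_⟩
          rw [smul_eq_mul, mul_left_comm]
          exact Ideal.mul_mem_left _ _ hx }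
  have hB : ∀ Q : Ideal S, Q.IsPrime → ∀ f, f ∈ B Q ↔ ∃ t, t ∉ Q ∧ t * f ∈ Q * J ⊔ I :=
    fun Q hQ f => ⟨fun h => h.resolve_left (not_not.2 hQ), Or.inr⟩
  let t : Set (Ideal S) := ⋃ e ∈ Set.Iic (d + ε), (genIdeal (V : Set S) J I e).minimalPrimes
  have ht : t.Finite := (Set.finite_Iic _).biUnion fun e _ =>
    Ideal.finite_minimalPrimes_of_isNoetherianRing S _
  refine (isGeneric_forall_notMem ht (W := fun Q => (B Q).restrictScalars k) ?_).mono ?_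
  · intro Q hQ hVQ
    simp only [t, Set.mem_iUnion] at hQ
    obtain ⟨e, -, hQ⟩ := hQ
    have hQp : Q.IsPrime := hQ.1.1
    have h0 : GenBy (V : Set S) J I Q e := (genBy_zero_iff.2 (exists_mul_mem_of_nakayama hJ
      (exists_mul_mem_of_forall hJ hV fun v hv => (hB Q hQp v).1 (hVQ hv)))).mono le_rfl
      (Nat.zero_le _)
    exact genBy_iff.1 h0 hQ.1.2
  · intro f hf hft P s hs hsd
    have hle : I ≤ I ⊔ Ideal.span {f} := le_sup_left
    obtain he | he := Nat.eq_zero_or_pos (s + ε - i)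
    · exact (h P s hs hsd).mono hle (by omega)
    by_cases hP : GenBy (V : Set S) J I P.asIdeal (s + ε - (i + 1))
    · exact hP.mono hle le_rfl
    rw [genBy_iff, not_not] at hP
    obtain ⟨Q, hQ, hQP⟩ := Ideal.exists_minimalPrimes_le hP
    have hQp : Q.IsPrime := hQ.1.1
    let Q' : PrimeSpectrum S := ⟨Q, hQp⟩
    have hQP' : Q' ≤ P := hQP
    obtain hlt | heq := hQP'.lt_or_eq
    · have hfin : Order.height Q' < s := by
        rw [← hs]
        exact Order.height_strictMono hlt
          ((Order.height_mono hQP').trans_lt (by rw [hs]; exact ENat.natCast_lt_top s))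
      obtain ⟨q, hq⟩ := ENat.ne_top_iff_exists.1 (ne_top_of_lt hfin)
      rw [← hq] at hfin
      have hqs : q < s := by exact_mod_cast hfin
      exact absurd hQ.1.2 (genBy_iff.1 ((h Q' q hq.symm (by omega)).mono le_rfl (by omega)))
    · subst heq
      have h1 : s + ε - i = s + ε - (i + 1) + 1 := by omega
      refine GenBy.exchange hVJ (h1 ▸ h Q' s hs hsd) (hVJ hf) fun h2 => ?_
      refine hft Q ?_ ((hB Q hQp f).2 h2)
      simp only [t, Set.mem_iUnion]
      exact ⟨_, Set.mem_Iic.2 (by omega), hQ⟩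

end BasicSequences

section IrrelevantPrimary

variable {k S : Type*} [Field k] [CommRing S] [Algebra k S] {𝒜 : ℕ → Submodule k S}
  [GradedAlgebra 𝒜] (hstd : ∀ n : ℕ, 𝒜 n = 𝒜 1 ^ n)

include hstd

lemma le_gPlus_of_isHomogeneous {P : Ideal S} (hP : P ≠ ⊤) (hh : P.IsHomogeneous 𝒜) :
    P ≤ gPlus 𝒜 := by
  intro x hx
  rw [← pow_one (gPlus 𝒜), mem_gPlus_pow_iff hstd]
  intro c hc
  obtain rfl : c = 0 := by omega
  have h0 : GradedAlgebra.proj 𝒜 0 x ∈ P := by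
    rw [GradedAlgebra.proj_apply]; exact hh 0 hx
  have h1 := proj_mem 𝒜 0 x
  rw [grade_zero hstd, Submodule.mem_one] at h1
  obtain ⟨u, hu⟩ := h1
  by_contra hne
  have hu0 : u ≠ 0 := fun h => hne (by rw [← hu, h, map_zero])
  rw [← hu] at h0
  exact hP (P.eq_top_of_isUnit_mem h0 ((IsUnit.mk0 u hu0).map _))

/-- A homogeneous ideal contained in no prime of height less than `dim S` contains a power of
the irrelevant ideal. -/
lemma exists_gPlus_pow_le [IsNoetherianRing S] [hprime : (gPlus 𝒜).IsPrime] {d : ℕ}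
    (hdim : ringKrullDim S = (d : WithBot ℕ∞)) {K : Ideal S} (hK : K.IsHomogeneous 𝒜)
    (h : ∀ P : PrimeSpectrum S, ∀ s : ℕ, Order.height P = s → s < d → ¬ K ≤ P.asIdeal) :
    ∃ a, gPlus 𝒜 ^ a ≤ K := by
  refine Ideal.exists_pow_le_of_le_radical_of_fg ?_ (IsNoetherian.noetherian _)
  rw [Ideal.radical_eq_sInf]
  refine le_sInf fun P ⟨hKP, hP⟩ => ?_
  let M : PrimeSpectrum S := ⟨gPlus 𝒜, hprime⟩
  let Q : PrimeSpectrum S := ⟨(P.homogeneousCore 𝒜).toIdeal, hP.homogeneousCore⟩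
  have hQM : Q ≤ M := le_gPlus_of_isHomogeneous hstd Q.2.ne_top (P.homogeneousCore 𝒜).isHomogeneous
  have hKQ : K ≤ Q.asIdeal := by
    rw [← hK.toIdeal_homogeneousCore_eq_self]
    exact Ideal.homogeneousCore_mono 𝒜 hKP
  have hheight : ∀ p : PrimeSpectrum S, Order.height p ≤ (d : ℕ∞) := fun p => by
    have h1 : ((Order.height p : ℕ∞) : WithBot ℕ∞) ≤ (d : WithBot ℕ∞) := by
      rw [← hdim]; exact Order.height_le_krullDim p
    exact WithBot.coe_le_coe.1 h1
  obtain hlt | heq := hQM.lt_or_eq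
  · have h1 : Order.height Q < (d : ℕ∞) := (Order.height_strictMono hlt
      ((hheight Q).trans_lt (ENat.natCast_lt_top d))).trans_le (hheight M)
    obtain ⟨q, hq⟩ := ENat.ne_top_iff_exists.1 (ne_top_of_lt h1)
    rw [← hq] at h1
    exact absurd hKQ (h Q q hq.symm (by exact_mod_cast h1))
  · calc gPlus 𝒜 = Q.asIdeal := congrArg PrimeSpectrum.asIdeal heq.symm
      _ ≤ P := Ideal.toIdeal_homogeneousCore_le 𝒜 P

omit hstd in
lemma mem_mul_sup_mul {X Y : Submodule k S} {s s' b b' : ℕ} (hX : X ≤ 𝒜 s) (hY : Y ≤ 𝒜 s')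
    (hb : s + b = s' + b') {y : S} (hy : y ∈ Ideal.span (X : Set S) ⊔ Ideal.span (Y : Set S))
    (hyb : y ∈ 𝒜 (s + b)) : y ∈ X * 𝒜 b ⊔ Y * 𝒜 b' := by
  obtain ⟨u, hu, v, hv, rfl⟩ := Submodule.mem_sup.1 hy
  rw [← proj_eq_self hyb, map_add]
  refine add_mem (Submodule.mem_sup_left (proj_mem_mul_of_mem_span hX hu b))
    (Submodule.mem_sup_right ?_)
  rw [hb]
  exact proj_mem_mul_of_mem_span hY hv _

/-- If `V` lies in the ideal generated by `X` and `Y`, locally at all primes of height less than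
`dim S`, then it does so in all large degrees. -/
lemma exists_mul_le_mul_sup_mul [IsNoetherianRing S] [hprime : (gPlus 𝒜).IsPrime] {d : ℕ}
    (hdim : ringKrullDim S = (d : WithBot ℕ∞)) {V X Y : Submodule k S} {r s s' : ℕ}
    (hV : V ≤ 𝒜 r) (hX : X ≤ 𝒜 s) (hY : Y ≤ 𝒜 s')
    (h : ∀ P : PrimeSpectrum S, ∀ s : ℕ, Order.height P = s → s < d →
      ∃ t, t ∉ P.asIdeal ∧ ∀ v ∈ V, t * v ∈ Ideal.span (X : Set S) ⊔ Ideal.span (Y : Set S)) :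
    ∃ a, ∀ n b b', a ≤ n → s + b = r + n → s' + b' = r + n →
      V * 𝒜 n ≤ X * 𝒜 b ⊔ Y * 𝒜 b' := by
  set T := Ideal.span (X : Set S) ⊔ Ideal.span (Y : Set S) with hT
  have hTproj : ∀ y ∈ T, ∀ c, GradedAlgebra.proj 𝒜 c y ∈ T := by
    intro y hy c
    obtain ⟨u, hu, v, hv, rfl⟩ := Submodule.mem_sup.1 hy
    rw [map_add]
    exact add_mem (Submodule.mem_sup_left (proj_mem_span_of_mem hX hu c))
      (Submodule.mem_sup_right (proj_mem_span_of_mem hY hv c))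
  let K : Ideal S :=
    { carrier := {t | ∀ v ∈ V, t * v ∈ T}
      add_mem' := fun ha hb v hv => by rw [add_mul]; exact add_mem (ha v hv) (hb v hv)
      zero_mem' := fun v _ => by rw [zero_mul]; exact zero_mem _
      smul_mem' := fun c a ha v hv => by
        rw [smul_eq_mul, mul_assoc]; exact Ideal.mul_mem_left _ _ (ha v hv) }
  have hK : K.IsHomogeneous 𝒜 := by
    intro c t ht v hv
    rw [← GradedAlgebra.proj_apply, mul_comm, ← proj_mul (hV hv), mul_comm]
    exact hTproj _ (ht v hv) _
  obtain ⟨a, ha⟩ := exists_gPlus_pow_le hstd hdim hK fun P s hs hsd hKP => by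
    obtain ⟨t, ht, htv⟩ := h P s hs hsd
    exact ht (hKP htv)
  refine ⟨a, fun n b b' hn hb hb' => Submodule.mul_le.2 fun v hv y hy => ?_⟩
  refine mem_mul_sup_mul hX hY (hb.trans hb'.symm) ?_ ?_
  · rw [mul_comm]
    exact ha (grade_le_gPlus_pow hstd hn hy) v hv
  · rw [hb, ← grade_mul hstd]
    exact Submodule.mul_mem_mul (hV hv) hy

end IrrelevantPrimary

section GenericSequences

variable {k S : Type*} [Field k] [Infinite k] [CommRing S] [IsNoetherianRing S] [Algebra k S]
  {𝒜 : ℕ → Submodule k S} [GradedAlgebra 𝒜] (hstd : ∀ n : ℕ, 𝒜 n = 𝒜 1 ^ n)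

include hstd

/-- There are sequences of any length which are filter-regular and basic. -/
lemma exists_filterRegSeq {V : Submodule k S} {J : Ideal S} {r d : ℕ} (hVr : V ≤ 𝒜 r)
    (hV : Ideal.span (V : Set S) = J) (hG : SatisfiesG J d) (i : ℕ) :
    ∃ f : Fin i → S, (∀ j, f j ∈ V) ∧ FilterRegSeq 𝒜 V i f ∧
      GenUpTo (V : Set S) J (J * J ⊔ Ideal.span (Set.range f)) d 0 i ∧
      GenUpTo (V : Set S) J (⊥ ⊔ Ideal.span (Set.range f)) d 1 i := by
  induction i with
  | zero =>
    refine ⟨Fin.elim0, fun j => j.elim0, trivial, ?_, ?_⟩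
    · simpa using genUpTo_sq hV hG
    · simpa using genUpTo_bot hV hG
  | succ i ih =>
    obtain ⟨f, hfV, hf, h1, h2⟩ := ih
    obtain ⟨h, hhV, ⟨hh, hh1⟩, hh2⟩ :=
      (((isGeneric_filterReg hstd hVr (span_range_le hfV)).and (h1.isGeneric hV)).and
        (h2.isGeneric hV)).exists
    have hspan : Ideal.span (Set.range (Fin.snoc f h : Fin (i + 1) → S)) =
        Ideal.span (Set.range f) ⊔ Ideal.span {h} := by
      rw [← Ideal.span_union, Fin.range_snoc, Set.union_singleton]
    refine ⟨Fin.snoc f h, fun j => ?_, ⟨?_, ?_⟩, ?_, ?_⟩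
    · refine Fin.lastCases ?_ (fun j => ?_) j
      · rwa [Fin.snoc_last]
      · rw [Fin.snoc_castSucc]; exact hfV j
    · rwa [Fin.init_snoc]
    · rwa [Fin.init_snoc, Fin.snoc_last]
    · rwa [hspan, ← sup_assoc]
    · rwa [hspan, ← sup_assoc]

lemma exists_filterRegSeq_surjAt [hprime : (gPlus 𝒜).IsPrime] {V : Submodule k S} {J : Ideal S}
    {r d : ℕ} (hVr : V ≤ 𝒜 r) (hV : Ideal.span (V : Set S) = J)
    (hdim : ringKrullDim S = ((d + 1 : ℕ) : WithBot ℕ∞)) (hG : SatisfiesG J (d + 1)) :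
    ∃ f : Fin d → S, (∀ j, f j ∈ V) ∧ FilterRegSeq 𝒜 V d f ∧ ∃ h ∈ V, ∃ a,
      SurjAt 𝒜 V (Submodule.span k (Set.range f)) h r a := by
  obtain ⟨f, hfV, hf, h1, h2⟩ := exists_filterRegSeq hstd hVr hV hG d
  obtain ⟨h, hh, h3⟩ := (h2.isGeneric hV).exists
  set L := Submodule.span k (Set.range f) with hL
  have hLr : L ≤ 𝒜 r := (span_range_le hfV).trans hVr
  have hhr : Submodule.span k {h} ≤ 𝒜 r := by
    rw [Submodule.span_singleton_le_iff_mem]; exact hVr hh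
  have hVV : V * V ≤ 𝒜 (r + r) := by rw [← grade_mul hstd]; exact mul_le_mul' hVr hVr
  have hspanL : Ideal.span (Set.range f) = Ideal.span (L : Set S) :=
    (ideal_span_submodule_span _).symm
  have hJJ : J * J = Ideal.span ((V * V : Submodule k S) : Set S) := by
    rw [ideal_span_mul, hV]
  have hVJ : ∀ v ∈ V, v ∈ J := fun v hv => hV ▸ Ideal.subset_span hv
  refine ⟨f, hfV, hf, h, hh, ?_⟩
  obtain ⟨a, ha⟩ := exists_mul_le_mul_sup_mul hstd hdim hVr hLr hVV fun P s hs hsd => by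
    have := h1 P s hs hsd
    rw [show s + 0 - d = 0 by omega, genBy_zero_iff] at this
    obtain ⟨t, ht, h⟩ := this
    refine ⟨t, ht, fun v hv => ?_⟩
    rw [← hspanL, ← hJJ, sup_comm]
    exact h v (hVJ v hv)
  obtain ⟨b, hb⟩ := exists_mul_le_mul_sup_mul hstd hdim hVr hLr hhr fun P s hs hsd => by
    have := h3 P s hs hsd
    rw [show s + 1 - (d + 1) = 0 by omega, genBy_zero_iff] at this
    obtain ⟨t, ht, h⟩ := this
    refine ⟨t, ht, fun v hv => ?_⟩
    rw [← hspanL, ideal_span_submodule_span]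
    simpa using h v (hVJ v hv)
  refine ⟨max a b, ?_⟩
  set n := max a b with hn
  have ha' := ha (n + r) (n + r) n (by omega) rfl (by omega)
  have hb' := hb n n n (by omega) rfl rfl
  refine ha'.trans (sup_le le_sup_left ?_)
  calc V * V * 𝒜 n = V * (V * 𝒜 n) := mul_assoc _ _ _
    _ ≤ V * (L * 𝒜 n ⊔ Submodule.span k {h} * 𝒜 n) := mul_le_mul' le_rfl hb'
    _ = L * (V * 𝒜 n) ⊔ Submodule.span k {h} * (V * 𝒜 n) := by
      rw [Submodule.mul_sup, mul_left_comm, mul_left_comm V]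
    _ ≤ _ := by
      refine sup_le_sup_right (mul_le_mul' le_rfl ?_) _
      rw [add_comm n r, ← grade_mul hstd]
      exact mul_le_mul' hVr le_rfl

end GenericSequences
/-- Corollary 3a: let `S` be a `d`-dimensional standard graded algebra over an infinite
field `k`, `𝔫 = S₊`, `R = S_𝔫`, `J` an ideal generated by homogeneous elements of degree
`r > 0` and `I = JR`.  If `ℓ(I) = d` and `J` satisfies `G_d`, then for general homogeneous
`f₁, …, f_{d−1} ∈ J` of degree `r`, `j(I) = r · e(S/((f₁, …, f_{d−1}) :_S J))`, where `e`
is the multiplicity with respect to `𝔫`. -/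
theorem stmt_12 {k S : Type*} [Field k] [Infinite k] [CommRing S] [IsNoetherianRing S]
    [Algebra k S] (𝒜 : ℕ → Submodule k S) [GradedAlgebra 𝒜]
    (hstd : ∀ n : ℕ, 𝒜 n = 𝒜 1 ^ n)
    (d : ℕ) (hd : 0 < d) (hdim : ringKrullDim S = (d : WithBot ℕ∞))
    [hprime : (gPlus 𝒜).IsPrime]
    (r : ℕ) (hr : 0 < r)
    (J : Ideal S) (hJ : ∃ X : Set S, X ⊆ (𝒜 r : Set S) ∧ Ideal.span X = J)
    (hspread : idealSpread
        (IsLocalRing.maximalIdeal (Localization.AtPrime (gPlus 𝒜)))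
        (Ideal.map (algebraMap S (Localization.AtPrime (gPlus 𝒜))) J) =
      (d : WithBot ℕ∞))
    (hG : SatisfiesG J d) :
    GeneralHomog 𝒜 r J (d - 1) fun f =>
      jMult (IsLocalRing.maximalIdeal (Localization.AtPrime (gPlus 𝒜)))
          (Ideal.map (algebraMap S (Localization.AtPrime (gPlus 𝒜))) J)
          (Localization.AtPrime (gPlus 𝒜)) d =
        (r : ℝ) *
          hsMult (gPlus 𝒜) (S ⧸ Submodule.colon (Ideal.span (Set.range f)) J) 1 := by
  obtain ⟨d, rfl⟩ := Nat.exists_eq_succ_of_ne_zero hd.ne'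
  simp only [Nat.succ_eq_add_one] at *
  intro m x hx hxJ
  set V := Submodule.span k (Set.range x) with hVdef
  have hxV : ∀ l, x l ∈ V := fun l => Submodule.subset_span ⟨l, rfl⟩
  have hVr : V ≤ 𝒜 r := Submodule.span_le.2 (Set.range_subset_iff.2 hx)
  have hV : Ideal.span (V : Set S) = J := by rw [hVdef, ideal_span_submodule_span, hxJ]
  obtain ⟨f, hfV, hf, h, hh, a, hC⟩ := exists_filterRegSeq_surjAt hstd hVr hV hdim hG
  obtain ⟨g, hgV, hg, -⟩ := exists_filterRegSeq hstd hVr hV hG 2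
  choose c hc using fun j => (Submodule.mem_span_range_iff_exists_fun k).1 (hfV j)
  obtain rfl : linComb x (fun p => c p.1 p.2) = f := funext hc
  obtain ⟨F, hF, hFc⟩ := exists_polynomial_jMult_eq hstd hVr hr (grade_fg hstd) hxV _ hh hC hf hgV hg
  subst hV
  exact ⟨F, hF, hFc⟩

end
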